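/- arXiv:1306.4628 — 3 statements merged into one kernel-verified Lean document; each statement's English description precedes it below -/
import Mathlib

section
/- For j = 0, 1, 2 let r_j(n,k) denote the number of reduced permutations of {1,…,n} of genus 1 having exactly j back points and exactly k cycles. Then for all integers n ≥ 0 and k ≥ 1: r₁(n,k) = C(n,2k+1)·(C(k+2,3) + C(k+1,3)) and r₂(n,k) = C(n,2k+2)·C(k+2,3), where C(a,b) denotes the binomial coefficient. -/
/-- The setoid on `Fin n` whose equivalence classes are the cycles (orbits) of the
permutation `α`. -/
def cycleSetoid {n : ℕ} (α : Equiv.Perm (Fin n)) : Setoid (Fin n) :=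
  ⟨α.SameCycle,
    ⟨fun x => Equiv.Perm.SameCycle.refl α x, fun h => h.symm, fun h h' => h.trans h'⟩⟩

/-- `zPerm α` is the number of cycles of `α`, i.e. the number of orbits of `⟨α⟩` acting
on `Fin n` (fixed points counting as cycles). -/
noncomputable def zPerm {n : ℕ} (α : Equiv.Perm (Fin n)) : ℕ :=
  Nat.card (Quotient (cycleSetoid α))

/-- `α` has genus one, i.e. `z(α) + z(α⁻¹ ∘ ζₙ) = n - 1` (written additively).
Here `finRotate n` plays the role of the cycle `ζₙ = (1, 2, …, n)`. -/
def IsGenusOne {n : ℕ} (α : Equiv.Perm (Fin n)) : Prop :=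
  zPerm α + zPerm (α⁻¹ * finRotate n) + 2 = n + 1

/-- `i` is a back point of `α`: `α i < i` and `α i` is not the smallest element of the
cycle (orbit) of `α` containing `i`. -/
def IsBackPoint {n : ℕ} (α : Equiv.Perm (Fin n)) (i : Fin n) : Prop :=
  α i < i ∧ ∃ j : Fin n, α.SameCycle i j ∧ j < α i

/-- The number of back points of `α`. -/
noncomputable def backPointCount {n : ℕ} (α : Equiv.Perm (Fin n)) : ℕ :=
  Nat.card {i : Fin n // IsBackPoint α i}

/-- `α` is the permutation associated with a set partition (each block of the partition
is a cycle of `α`, traversed in increasing order); equivalently, `α` has no back point. -/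
def IsPartitionPerm {n : ℕ} (α : Equiv.Perm (Fin n)) : Prop :=
  ∀ i : Fin n, ¬ IsBackPoint α i

/-- The points `i, ζ i, …, ζᵖ i` (where `ζ = finRotate n`) form a trivial cycle of `α`:
a cycle consisting of cyclically consecutive points, each sent to the cyclically next
one, the last back to the first. -/
def IsTrivialCycleAt {n : ℕ} (α : Equiv.Perm (Fin n)) (i : Fin n) (p : ℕ) : Prop :=
  p < n ∧ (∀ t : ℕ, t < p → α ((finRotate n ^ t) i) = (finRotate n ^ (t + 1)) i) ∧
    α ((finRotate n ^ p) i) = i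

/-- `α` is reduced: it contains no trivial cycle. -/
def IsReducedPerm {n : ℕ} (α : Equiv.Perm (Fin n)) : Prop :=
  ¬ ∃ (i : Fin n) (p : ℕ), IsTrivialCycleAt α i p

section Cycles

open Equiv Finset

variable {n : ℕ}

lemma perm_apply_inv (α : Perm (Fin n)) (i : Fin n) : α (α⁻¹ i) = i :=
  α.apply_symm_apply i

lemma perm_inv_apply (α : Perm (Fin n)) (i : Fin n) : α⁻¹ (α i) = i :=
  α.symm_apply_apply i

lemma SameCycle.invariant {α : Perm (Fin n)} {X : Type*} {φ : Fin n → X}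
    (h : ∀ i, φ (α i) = φ i) {i j : Fin n} (hij : α.SameCycle i j) : φ i = φ j := by
  obtain ⟨t, -, rfl⟩ := hij.exists_pow_eq'
  induction t with
  | zero => rfl
  | succ t ih =>
    rw [pow_succ', Perm.mul_apply, h]
    exact ih ⟨t, by simp⟩

lemma zPerm_inv (α : Perm (Fin n)) : zPerm α⁻¹ = zPerm α := by
  unfold zPerm
  congr 2
  ext i j
  exact Perm.sameCycle_inv

lemma zPerm_conj (σ α : Perm (Fin n)) : zPerm (σ * α * σ⁻¹) = zPerm α := by
  refine Nat.card_congr (Quotient.congr σ⁻¹ fun i j => ?_)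
  exact Perm.sameCycle_conj

/-- A function constant along the cycles of `α` bounds the number of cycles from below. -/
lemma card_le_zPerm_of_invariant {α : Perm (Fin n)} (φ : Fin n → ℕ)
    (h : ∀ i, φ (α i) = φ i) (s : Finset ℕ) (hs : ∀ x ∈ s, ∃ i, φ i = x) :
    s.card ≤ zPerm α := by
  classical
  let F : Quotient (cycleSetoid α) → ℕ :=
    Quotient.lift φ fun i j hij => SameCycle.invariant h hij
  have : Fintype (Quotient (cycleSetoid α)) := Fintype.ofFinite _
  rw [zPerm, Nat.card_eq_fintype_card]
  calc s.card ≤ (univ.image F).card := by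
        refine card_le_card fun x hx => ?_
        obtain ⟨i, rfl⟩ := hs x hx
        exact mem_image.2 ⟨Quotient.mk _ i, mem_univ _, rfl⟩
    _ ≤ _ := card_image_le

lemma exists_sameCycle_min (α : Perm (Fin n)) (i : Fin n) :
    ∃ j, α.SameCycle i j ∧ ∀ l, α.SameCycle i l → j ≤ l := by
  classical
  obtain ⟨j, hj, hmin⟩ := (univ.filter fun j => α.SameCycle i j).exists_minimal
    ⟨i, mem_filter.2 ⟨mem_univ _, .refl _ _⟩⟩
  simp only [mem_filter, mem_univ, true_and] at hj hmin
  exact ⟨j, hj, fun l hl => (le_total j l).elim id fun h => hmin hl h⟩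

/-- The cycle of an excedance. -/
def excedanceCycle (α : Perm (Fin n)) (i : {i // i < α i}) :
    Quotient (cycleSetoid α) := Quotient.mk _ i.1

lemma excedanceCycle_surjective {α : Perm (Fin n)} (hα : ∀ i, α i ≠ i) :
    Function.Surjective (excedanceCycle α) := by
  refine Quotient.ind fun i => ?_
  obtain ⟨j, hij, hmin⟩ := exists_sameCycle_min α i
  refine ⟨⟨j, lt_of_le_of_ne (hmin _ (Perm.sameCycle_apply_right.2 hij)) (hα j).symm⟩, ?_⟩
  exact Quotient.sound (s := cycleSetoid α) hij.symm

lemma zPerm_le_card_excedances {α : Perm (Fin n)} (hα : ∀ i, α i ≠ i) :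
    zPerm α ≤ #{i | i < α i} := by
  have := Nat.card_le_card_of_surjective _ (excedanceCycle_surjective hα)
  rwa [Nat.card_eq_fintype_card (α := {i // i < α i}), Fintype.card_subtype] at this

lemma excedance_unique {α : Perm (Fin n)} (hα : ∀ i, α i ≠ i)
    (hz : zPerm α = #{i | i < α i}) {i j : Fin n} (hi : i < α i) (hj : j < α j)
    (hij : α.SameCycle i j) : i = j := by
  have hb : Function.Bijective (excedanceCycle α) := by
    have : Fintype (Quotient (cycleSetoid α)) := Fintype.ofFinite _
    refine (Fintype.bijective_iff_surjective_and_card _).2 ⟨excedanceCycle_surjective hα, ?_⟩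
    rw [Fintype.card_subtype, ← hz, zPerm, Nat.card_eq_fintype_card]
  have := @hb.1 ⟨i, hi⟩ ⟨j, hj⟩ (Quotient.sound (s := cycleSetoid α) hij)
  exact congrArg Subtype.val this

lemma card_excedances_inv (α : Perm (Fin n)) :
    #{i | α⁻¹ i < i} = #{i | i < α i} := by
  refine (card_bij (fun i _ => α i) ?_ (fun _ _ _ _ h => α.injective h) ?_).symm
  · simp
  · intro j hj
    exact ⟨α⁻¹ j, by simpa using hj, by simp⟩

lemma card_excedances_add {α : Perm (Fin n)} (hα : ∀ i, α i ≠ i) :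
    #{i | i < α i} + #{i | α i < i} = n := by
  have : (univ.filter fun i => α i < i) = univ.filter fun i => ¬ i < α i := by
    ext i
    simp only [mem_filter, mem_univ, true_and, not_lt]
    exact ⟨le_of_lt, fun h => lt_of_le_of_ne h (hα i)⟩
  rw [this, card_filter_add_card_filter_not, card_univ, Fintype.card_fin]

lemma finRotate_val (i : Fin n) :
    (finRotate n i : ℕ) = if (i : ℕ) + 1 = n then 0 else (i : ℕ) + 1 := by
  obtain _ | n := n
  · exact i.elim0
  · rw [coe_finRotate]
    simp only [Fin.ext_iff, Fin.val_last, Nat.add_right_cancel_iff]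

lemma finRotate_inv_val (i : Fin n) :
    (((finRotate n)⁻¹ i : Fin n) : ℕ) = if (i : ℕ) = 0 then n - 1 else (i : ℕ) - 1 := by
  have h := finRotate_val ((finRotate n)⁻¹ i)
  rw [perm_apply_inv] at h
  split_ifs at h ⊢ <;> omega

lemma card_antiexcedances {α : Perm (Fin n)} (hn : 0 < n) (hα : ∀ i, α i ≠ i) :
    #{i | α i < i} = #{i | ((finRotate n)⁻¹ * α) i < i} + 1 := by
  have hins : (univ.filter fun i => α i < i) =
      insert (α⁻¹ ⟨0, hn⟩) (univ.filter fun i => ((finRotate n)⁻¹ * α) i < i) := by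
    ext i
    have h1 := finRotate_inv_val (α i)
    have h2 := hα i
    simp only [mem_filter, mem_univ, true_and, mem_insert, Perm.mul_apply, Fin.lt_def,
      Perm.eq_inv_iff_eq, Fin.ext_iff, ne_eq] at h2 ⊢
    split_ifs at h1 <;> omega
  rw [hins, card_insert_of_notMem]
  simp only [mem_filter, mem_univ, true_and, Perm.mul_apply, perm_apply_inv, Fin.lt_def,
    finRotate_inv_val]
  have := (α⁻¹ ⟨0, hn⟩).2
  simp only [if_true]
  omega

/-- The number of points that are mapped down is the number of cycles plus the number of
back points. -/
lemma backPointCount_add_zPerm {α : Perm (Fin n)} (hα : ∀ i, α i ≠ i) :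
    backPointCount α + zPerm α = #{i | α i < i} := by
  classical
  have hb : backPointCount α = #{i | IsBackPoint α i} := by
    rw [backPointCount, Nat.card_eq_fintype_card, Fintype.card_subtype]
  have hz : zPerm α = #{i | α i < i ∧ ∀ j, α.SameCycle i j → α i ≤ j} := by
    rw [← Fintype.card_subtype, ← Nat.card_eq_fintype_card, zPerm]
    symm
    refine Nat.card_congr (Equiv.ofBijective
      (fun i => (Quotient.mk _ i.1 : Quotient (cycleSetoid α))) ⟨?_, Quotient.ind fun i => ?_⟩)
    · rintro ⟨i, hi, hi'⟩ ⟨j, hj, hj'⟩ h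
      have hij : α.SameCycle i j := Quotient.exact h
      exact Subtype.ext (α.injective (le_antisymm (hi' _ (Perm.sameCycle_apply_right.2 hij))
        (hj' _ (Perm.sameCycle_apply_right.2 hij.symm))))
    · obtain ⟨j, hij, hmin⟩ := exists_sameCycle_min α i
      refine ⟨⟨α⁻¹ j, ?_, ?_⟩, Quotient.sound (s := cycleSetoid α)
        (Perm.sameCycle_symm_apply_right.2 hij).symm⟩
      · rw [perm_apply_inv]
        refine lt_of_le_of_ne (hmin _ (Perm.sameCycle_symm_apply_right.2 hij)) fun h => ?_
        exact hα j (by conv_lhs => rw [h, perm_apply_inv])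
      · intro l hl
        rw [perm_apply_inv]
        exact hmin _ ((Perm.sameCycle_symm_apply_right.2 hij).trans hl)
  rw [hb, hz, ← card_union_of_disjoint]
  · congr 1
    ext i
    rw [mem_union, mem_filter, mem_filter, mem_filter]
    simp only [mem_univ, true_and]
    constructor
    · rintro (h | h) <;> exact h.1
    · intro h
      by_cases h' : ∃ j, α.SameCycle i j ∧ j < α i
      · exact Or.inl ⟨h, h'⟩
      · push Not at h'
        exact Or.inr ⟨h, h'⟩
  · refine disjoint_left.2 fun i hi hi' => ?_
    obtain ⟨-, -, j, hj, hlt⟩ := mem_filter.1 hi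
    exact absurd ((mem_filter.1 hi').2.2 j hj) (not_le.2 hlt)

/-- Neither `α` nor `α⁻¹ ∘ ζ` has a fixed point. -/
def IsPrimitivePerm (α : Perm (Fin n)) : Prop :=
  (∀ i, α i ≠ i) ∧ ∀ i, α i ≠ finRotate n i

lemma IsPrimitivePerm.dual_ne {α : Perm (Fin n)} (h : IsPrimitivePerm α) (i : Fin n) :
    (α⁻¹ * finRotate n) i ≠ i := by
  rw [Perm.mul_apply, ne_eq, Perm.inv_eq_iff_eq]
  exact (h.2 i).symm

lemma IsPrimitivePerm.card_excedances {α : Perm (Fin n)} (h : IsPrimitivePerm α) (hn : 0 < n) :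
    #{i | i < α i} + #{i | i < (α⁻¹ * finRotate n) i} + 1 = n := by
  have h1 := card_excedances_add h.1
  have h2 := card_antiexcedances hn h.1
  have h3 := card_excedances_inv (α⁻¹ * finRotate n)
  rw [mul_inv_rev, inv_inv] at h3
  omega

lemma IsPrimitivePerm.zPerm_add_le {α : Perm (Fin n)} (h : IsPrimitivePerm α) (hn : 0 < n) :
    zPerm α + zPerm (α⁻¹ * finRotate n) + 1 ≤ n := by
  have := h.card_excedances hn
  have := zPerm_le_card_excedances h.1
  have := zPerm_le_card_excedances h.dual_ne
  omega

lemma IsPrimitivePerm.zPerm_eq {α : Perm (Fin n)} (h : IsPrimitivePerm α)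
    (hg : IsGenusOne α) : zPerm α = #{i | i < α i} ∧
      zPerm (α⁻¹ * finRotate n) = #{i | i < (α⁻¹ * finRotate n) i} := by
  have hn : 0 < n := by unfold IsGenusOne at hg; omega
  have := h.card_excedances hn
  have := zPerm_le_card_excedances h.1
  have := zPerm_le_card_excedances h.dual_ne
  unfold IsGenusOne at hg
  omega

end Cycles

section Reduction

open Equiv Finset

lemma finRotate_pow_val {n : ℕ} (t : ℕ) (x : Fin n) :
    ((finRotate n ^ t) x : ℕ) = (x + t) % n := by
  induction t with
  | zero => simp [Nat.mod_eq_of_lt x.2]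
  | succ t ih =>
    rw [pow_succ', Perm.mul_apply, finRotate_val, ih, ← add_assoc, Nat.add_mod _ 1]
    have := Nat.mod_lt (x + t) x.pos
    obtain h | h := Nat.lt_or_ge 1 n
    · rw [Nat.mod_eq_of_lt h]
      split_ifs with h'
      · rw [h', Nat.mod_self]
      · exact (Nat.mod_eq_of_lt (by omega)).symm
    · obtain rfl : n = 1 := by have := x.pos; omega
      simp [Nat.mod_one]

lemma exists_finRotate_pow {n : ℕ} (x y : Fin n) :
    ∃ t < n, (finRotate n ^ t) x = y := by
  have hn := x.pos
  have hx := x.2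
  have hy := y.2
  obtain h | h := le_or_gt x y
  · refine ⟨y - x, by omega, Fin.ext ?_⟩
    rw [finRotate_pow_val, Nat.add_sub_cancel' h, Nat.mod_eq_of_lt hy]
  · have h' : (y : ℕ) < x := h
    refine ⟨y + n - x, by omega, Fin.ext ?_⟩
    rw [finRotate_pow_val, Nat.add_sub_cancel' (by omega), Nat.add_mod_right,
      Nat.mod_eq_of_lt hy]

variable {m n : ℕ} {ι : Fin m → Fin n}

/-- The number of marked points below `t`. -/
def markedBelow (ι : Fin m → Fin n) (t : ℕ) : ℕ := #{i | (ι i : ℕ) < t}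

lemma markedBelow_apply (hι : StrictMono ι) (j : Fin m) :
    markedBelow ι (ι j) = j := by
  have : (univ.filter fun i => (ι i : ℕ) < ι j) = Finset.Iio j := by
    ext i
    simp only [mem_filter, mem_univ, true_and, mem_Iio]
    exact hι.lt_iff_lt
  rw [markedBelow, this, Fin.card_Iio]

lemma markedBelow_apply_succ (hι : StrictMono ι) (j : Fin m) :
    markedBelow ι (ι j + 1) = j + 1 := by
  have : (univ.filter fun i => (ι i : ℕ) < ι j + 1) = Finset.Iic j := by
    ext i
    simp only [mem_filter, mem_univ, true_and, mem_Iic, Nat.lt_succ_iff]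
    exact hι.le_iff_le
  rw [markedBelow, this, Fin.card_Iic]

lemma markedBelow_succ {x : Fin n} (hx : x ∉ Set.range ι) :
    markedBelow ι (x + 1) = markedBelow ι x := by
  unfold markedBelow
  congr 1
  ext i
  have : (ι i : ℕ) ≠ x := fun h => hx ⟨i, Fin.ext h⟩
  simp only [mem_filter, mem_univ, true_and]
  omega

/-- The first marked point at or after `x`, cyclically. -/
def nextMarked (ι : Fin m → Fin n) (hm : 0 < m) (x : Fin n) : Fin m :=
  ⟨markedBelow ι x % m, Nat.mod_lt _ hm⟩

lemma nextMarked_apply (hι : StrictMono ι) (hm : 0 < m) (j : Fin m) :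
    nextMarked ι hm (ι j) = j := by
  ext
  change markedBelow ι (ι j) % m = j
  rw [markedBelow_apply hι, Nat.mod_eq_of_lt j.2]

lemma nextMarked_finRotate_val (hm : 0 < m) (x : Fin n) :
    (nextMarked ι hm (finRotate n x) : ℕ) = markedBelow ι (x + 1) % m := by
  change markedBelow ι (finRotate n x) % m = _
  rw [finRotate_val]
  split_ifs with h
  · have h1 : markedBelow ι 0 = 0 := by simp [markedBelow]
    have h2 : markedBelow ι n = m := by simp [markedBelow]
    rw [h, h1, h2, Nat.mod_self, Nat.zero_mod]
  · rfl

lemma nextMarked_finRotate_of_notMem (hm : 0 < m) {x : Fin n}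
    (hx : x ∉ Set.range ι) : nextMarked ι hm (finRotate n x) = nextMarked ι hm x := by
  ext
  rw [nextMarked_finRotate_val, markedBelow_succ hx, nextMarked]

lemma nextMarked_finRotate_apply (hι : StrictMono ι) (hm : 0 < m) (j : Fin m) :
    nextMarked ι hm (finRotate n (ι j)) = finRotate m j := by
  ext
  rw [nextMarked_finRotate_val, markedBelow_apply_succ hι, finRotate_val]
  have := j.2
  split_ifs with h
  · rw [h, Nat.mod_self]
  · exact Nat.mod_eq_of_lt (by omega)

lemma nextMarked_pow (hm : 0 < m) {x : Fin n} {p : ℕ}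
    (hp : ∀ t < p, (finRotate n ^ t) x ∉ Set.range ι) :
    nextMarked ι hm ((finRotate n ^ p) x) = nextMarked ι hm x := by
  induction p with
  | zero => rfl
  | succ p ih =>
    rw [pow_succ', Perm.mul_apply, nextMarked_finRotate_of_notMem hm (hp p (by omega))]
    exact ih fun t ht => hp t (by omega)

lemma exists_pow_eq_nextMarked (hι : StrictMono ι) (hm : 0 < m) (x : Fin n) :
    ∃ p < n, (finRotate n ^ p) x = ι (nextMarked ι hm x) ∧
      ∀ t < p, (finRotate n ^ t) x ∉ Set.range ι := by
  classical
  have hex : ∃ p, (finRotate n ^ p) x ∈ Set.range ι := by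
    obtain ⟨t, -, ht⟩ := exists_finRotate_pow x (ι ⟨0, hm⟩)
    exact ⟨t, _, ht.symm⟩
  have hmin : ∀ t < Nat.find hex, (finRotate n ^ t) x ∉ Set.range ι :=
    fun t ht => Nat.find_min hex ht
  obtain ⟨j, hj⟩ := Nat.find_spec hex
  refine ⟨Nat.find hex, ?_, ?_, hmin⟩
  · obtain ⟨t, htn, ht⟩ := exists_finRotate_pow x (ι ⟨0, hm⟩)
    exact (Nat.find_min' hex ⟨_, ht.symm⟩).trans_lt htn
  · rw [← hj, ← nextMarked_pow hm hmin, ← hj, nextMarked_apply hι]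

variable {γ : Perm (Fin n)} {γ' : Perm (Fin m)}

/-- Unmarked points, which `γ` fixes, do not contribute to the cycles of `ζ ∘ γ`. -/
lemma zPerm_finRotate_mul (hι : StrictMono ι) (hm : 0 < m)
    (h1 : ∀ i, γ (ι i) = ι (γ' i)) (h2 : ∀ x, x ∉ Set.range ι → γ x = x) :
    zPerm (finRotate n * γ) = zPerm (finRotate m * γ') := by
  have hnext : ∀ x, (finRotate n * γ).SameCycle x (ι (nextMarked ι hm x)) := by
    intro x
    obtain ⟨p, -, hp, hlt⟩ := exists_pow_eq_nextMarked hι hm x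
    rw [← hp]
    clear hp
    induction p with
    | zero => exact .refl _ _
    | succ p ih =>
      refine (ih fun t ht => hlt t (by omega)).trans ?_
      have : (finRotate n * γ) ((finRotate n ^ p) x) = (finRotate n ^ (p + 1)) x := by
        rw [Perm.mul_apply, h2 _ (hlt p (by omega)), pow_succ', Perm.mul_apply]
      rw [← this]
      exact Perm.sameCycle_apply_right.2 (.refl _ _)
  have hF : ∀ i j, (finRotate m * γ').SameCycle i j →
      (finRotate n * γ).SameCycle (ι i) (ι j) := by
    intro i j hij
    refine Quotient.exact (s := cycleSetoid (finRotate n * γ)) (SameCycle.invariant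
      (φ := fun i => (Quotient.mk (cycleSetoid (finRotate n * γ)) (ι i))) (fun i => ?_) hij)
    refine Quotient.sound (s := cycleSetoid (finRotate n * γ)) ?_
    have h := hnext ((finRotate n * γ) (ι i))
    rw [Perm.mul_apply, h1, nextMarked_finRotate_apply hι, ← h1, ← Perm.mul_apply,
      Perm.sameCycle_apply_left] at h
    exact h.symm
  have hG : ∀ x y, (finRotate n * γ).SameCycle x y →
      (finRotate m * γ').SameCycle (nextMarked ι hm x) (nextMarked ι hm y) := by
    intro x y hxy
    refine Quotient.exact (s := cycleSetoid (finRotate m * γ')) (SameCycle.invariant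
      (φ := fun x => (Quotient.mk (cycleSetoid (finRotate m * γ')) (nextMarked ι hm x)))
      (fun x => ?_) hxy)
    refine Quotient.sound (s := cycleSetoid (finRotate m * γ')) ?_
    by_cases hx : x ∈ Set.range ι
    · obtain ⟨i, rfl⟩ := hx
      rw [Perm.mul_apply, h1, nextMarked_finRotate_apply hι, nextMarked_apply hι]
      exact (Perm.sameCycle_apply_left (f := finRotate m * γ')).2 (.refl _ _)
    · rw [Perm.mul_apply, h2 x hx, nextMarked_finRotate_of_notMem hm hx]
  exact Nat.card_congr
    { toFun := Quotient.lift (fun x => Quotient.mk (cycleSetoid (finRotate m * γ'))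
        (nextMarked ι hm x)) fun x y h => Quotient.sound (hG x y h)
      invFun := Quotient.lift (fun i => Quotient.mk (cycleSetoid (finRotate n * γ))
        (ι i)) fun i j h => Quotient.sound (hF i j h)
      left_inv := Quotient.ind fun x => Quotient.sound (hnext x).symm
      right_inv := Quotient.ind fun i =>
        congrArg (Quotient.mk (cycleSetoid (finRotate m * γ'))) (nextMarked_apply hι hm i) }

/-- Fixed points contribute one cycle each. -/
lemma zPerm_add_card_of_extend (hι : StrictMono ι)
    (h1 : ∀ i, γ (ι i) = ι (γ' i)) (h2 : ∀ x, x ∉ Set.range ι → γ x = x) :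
    zPerm γ + m = zPerm γ' + n := by
  classical
  let φ : Fin n → Quotient (cycleSetoid γ') ⊕ {x // x ∉ Set.range ι} := fun x =>
    if h : x ∈ Set.range ι then Sum.inl (Quotient.mk _ h.choose) else Sum.inr ⟨x, h⟩
  have hφ : ∀ i, φ (ι i) = Sum.inl (Quotient.mk _ i) := by
    intro i
    have h : ι i ∈ Set.range ι := ⟨i, rfl⟩
    simp only [φ, dif_pos h]
    rw [hι.injective h.choose_spec]
  have hφ' : ∀ x, (hx : x ∉ Set.range ι) → φ x = Sum.inr ⟨x, hx⟩ := fun x hx => dif_neg hx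
  have hinv : ∀ x, φ (γ x) = φ x := by
    intro x
    by_cases hx : x ∈ Set.range ι
    · obtain ⟨i, rfl⟩ := hx
      rw [h1, hφ, hφ]
      exact congrArg Sum.inl (Quotient.sound (s := cycleSetoid γ')
        (Perm.sameCycle_apply_left.2 (.refl _ _)))
    · rw [h2 x hx]
  have hF : ∀ i j, γ'.SameCycle i j → γ.SameCycle (ι i) (ι j) := by
    intro i j hij
    refine Quotient.exact (s := cycleSetoid γ) (SameCycle.invariant
      (φ := fun i => (Quotient.mk (cycleSetoid γ) (ι i))) (fun i => ?_) hij)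
    refine Quotient.sound (s := cycleSetoid γ) ?_
    rw [← h1]
    exact Perm.sameCycle_apply_left.2 (.refl _ _)
  let e : Quotient (cycleSetoid γ) ≃ Quotient (cycleSetoid γ') ⊕ {x // x ∉ Set.range ι} :=
    { toFun := Quotient.lift φ fun x y h => SameCycle.invariant hinv h
      invFun := Sum.elim (Quotient.lift (fun i => Quotient.mk (cycleSetoid γ) (ι i))
        fun i j h => Quotient.sound (hF i j h)) fun x => Quotient.mk _ x.1
      left_inv := by
        refine Quotient.ind fun x => ?_
        by_cases hx : x ∈ Set.range ι
        · obtain ⟨i, rfl⟩ := hx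
          simp only [Quotient.lift_mk, hφ, Sum.elim_inl]
        · simp only [Quotient.lift_mk, hφ' x hx, Sum.elim_inr]
      right_inv := by
        rintro (q | ⟨x, hx⟩)
        · induction q using Quotient.ind with
          | _ i => simp only [Sum.elim_inl, Quotient.lift_mk, hφ]
        · simp only [Sum.elim_inr, Quotient.lift_mk, hφ' x hx] }
  have hc : Nat.card {x // x ∉ Set.range ι} + m = n := by
    have h := Fintype.card_subtype_compl (fun x => x ∈ Set.range ι)
    have h' : Fintype.card {x // x ∈ Set.range ι} = m := by
      have := Fintype.card_congr (Equiv.ofInjective ι hι.injective)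
      rw [Fintype.card_fin] at this
      exact this.symm
    have hle := Fintype.card_le_of_injective ι hι.injective
    rw [h', Fintype.card_fin] at h
    rw [Nat.card_eq_fintype_card, h]
    simp only [Fintype.card_fin] at hle
    omega
  have := Nat.card_congr e
  rw [Nat.card_sum] at this
  unfold zPerm
  omega

lemma card_descents_extend (hι : StrictMono ι)
    (h1 : ∀ i, γ (ι i) = ι (γ' i)) (h2 : ∀ x, x ∉ Set.range ι → γ x = x) :
    #{x | γ x < x} = #{i | γ' i < i} := by
  refine (card_bij (fun i _ => ι i) ?_ (fun _ _ _ _ h => hι.injective h) ?_).symm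
  · intro i hi
    simpa [h1, hι.lt_iff_lt] using hi
  · intro x hx
    simp only [mem_filter, mem_univ, true_and] at hx
    by_cases hr : x ∈ Set.range ι
    · obtain ⟨i, rfl⟩ := hr
      refine ⟨i, ?_, rfl⟩
      simpa [h1, hι.lt_iff_lt] using hx
    · rw [h2 x hr] at hx
      exact absurd hx (lt_irrefl _)

/-- Trivial cycles correspond to fixed points once the unmarked points are removed. -/
lemma isReducedPerm_iff (hι : StrictMono ι) (hm : 0 < m)
    (h1 : ∀ i, γ (ι i) = ι (γ' i)) (h2 : ∀ x, x ∉ Set.range ι → γ x = x)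
    (h3 : ∀ i, γ' i ≠ i) :
    IsReducedPerm (finRotate n * γ) ↔ ∀ i, (finRotate m * γ') i ≠ i := by
  constructor
  · intro hr j hj
    refine hr ?_
    obtain ⟨p, hpn, hp, hlt⟩ :=
      exists_pow_eq_nextMarked hι hm ((finRotate n * γ) (ι j))
    have hn : nextMarked ι hm ((finRotate n * γ) (ι j)) = j := by
      rw [Perm.mul_apply, h1, nextMarked_finRotate_apply hι, ← Perm.mul_apply, hj]
    rw [hn] at hp
    refine ⟨_, p, hpn, fun t ht => ?_, by rw [hp]⟩
    rw [pow_succ', Perm.mul_apply (finRotate n) γ, h2 _ (hlt t ht)]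
    rfl
  · rintro h ⟨i, p, hpn, hlt, hp⟩
    have hnot : ∀ x, (finRotate n * γ) x = finRotate n x → x ∉ Set.range ι := by
      rintro x hx ⟨j, rfl⟩
      rw [Perm.mul_apply, h1] at hx
      exact h3 j (hι.injective ((finRotate n).injective hx))
    have hlt' : ∀ t < p, (finRotate n ^ t) i ∉ Set.range ι := fun t ht =>
      hnot _ (by rw [hlt t ht, pow_succ', Perm.mul_apply])
    by_cases hr : (finRotate n ^ p) i ∈ Set.range ι
    · obtain ⟨j, hj⟩ := hr
      have hc := nextMarked_pow hm hlt'
      rw [← hj, Perm.mul_apply, h1] at hp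
      rw [← hj, ← hp, hp, nextMarked_apply hι, ← hp, nextMarked_finRotate_apply hι] at hc
      exact h j hc.symm
    · have hret : (finRotate n ^ (p + 1)) i = i := by
        rw [Perm.mul_apply, h2 _ hr] at hp
        rw [pow_succ', Perm.mul_apply, hp]
      have hval := congrArg Fin.val hret
      rw [finRotate_pow_val] at hval
      have hpn' : p + 1 = n := by
        by_contra hne
        have hi := i.2
        obtain hlt | hge := Nat.lt_or_ge (i + (p + 1)) n
        · rw [Nat.mod_eq_of_lt hlt] at hval
          omega
        · rw [Nat.mod_eq_sub_mod hge, Nat.mod_eq_of_lt (by omega)] at hval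
          omega
      obtain ⟨t, htn, ht⟩ := exists_finRotate_pow i (ι ⟨0, hm⟩)
      obtain htp | rfl : t < p ∨ t = p := by omega
      · exact hlt' t htp ⟨_, ht.symm⟩
      · exact hr ⟨_, ht.symm⟩

end Reduction

section ReducedCount

open Equiv Finset

/-- Primitive genus-one permutations with `k` cycles. -/
def IsPrimitiveGenusOne (m k : ℕ) (α : Perm (Fin m)) : Prop :=
  IsPrimitivePerm α ∧ IsGenusOne α ∧ zPerm α = k

lemma dual_eq_inv {n : ℕ} (γ : Perm (Fin n)) :
    (finRotate n * γ)⁻¹ * finRotate n = γ⁻¹ := by group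

lemma zPerm_one (n : ℕ) : zPerm (1 : Perm (Fin n)) = n := by
  have e : Quotient (cycleSetoid (1 : Perm (Fin n))) ≃ Fin n :=
    { toFun := Quotient.lift id fun i j h => Perm.sameCycle_one.1 h
      invFun := Quotient.mk _
      left_inv := Quotient.ind fun _ => rfl
      right_inv := fun _ => rfl }
  rw [zPerm, Nat.card_congr e, Nat.card_eq_fintype_card, Fintype.card_fin]

lemma not_isGenusOne_finRotate {n : ℕ} : ¬ IsGenusOne (finRotate n) := by
  rw [IsGenusOne, inv_mul_cancel, zPerm_one]
  omega

lemma IsReducedPerm.apply_ne {n : ℕ} {α : Perm (Fin n)} (h : IsReducedPerm α) (i : Fin n) :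
    α i ≠ i := fun hi => h ⟨i, 0, i.pos, fun _ ht => absurd ht (Nat.not_lt_zero _), hi⟩

/-- Removing the points with `α i = ζ i` turns reduced genus-one permutations into primitive
ones, and the number of back points is determined by the number of remaining points. -/
lemma reduced_iff_primitive {m n : ℕ} {ι : Fin m → Fin n} {γ : Perm (Fin n)}
    {γ' : Perm (Fin m)} (hι : StrictMono ι) (hm : 0 < m)
    (h1 : ∀ i, γ (ι i) = ι (γ' i)) (h2 : ∀ x, x ∉ Set.range ι → γ x = x)
    (h3 : ∀ i, γ' i ≠ i) (k : ℕ) :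
    (IsGenusOne (finRotate n * γ) ∧ IsReducedPerm (finRotate n * γ) ∧
      zPerm (finRotate n * γ) = k ↔ IsPrimitiveGenusOne m k (finRotate m * γ')) ∧
    (IsPrimitiveGenusOne m k (finRotate m * γ') →
      backPointCount (finRotate n * γ) + 2 * k = m) := by
  have hz := zPerm_finRotate_mul hι hm h1 h2
  have hz' := zPerm_add_card_of_extend hι h1 h2
  have hr := isReducedPerm_iff hι hm h1 h2 h3
  have hn : 0 < n := (ι ⟨0, hm⟩).pos
  have hg : IsGenusOne (finRotate n * γ) ↔ IsGenusOne (finRotate m * γ') := by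
    rw [IsGenusOne, IsGenusOne, dual_eq_inv, dual_eq_inv, zPerm_inv, zPerm_inv, hz]
    omega
  have hp : IsPrimitivePerm (finRotate m * γ') ↔ ∀ i, (finRotate m * γ') i ≠ i := by
    refine ⟨fun h => h.1, fun h => ⟨h, fun i hi => h3 i ((finRotate m).injective hi)⟩⟩
  have hiff : IsGenusOne (finRotate n * γ) ∧ IsReducedPerm (finRotate n * γ) ∧
      zPerm (finRotate n * γ) = k ↔ IsPrimitiveGenusOne m k (finRotate m * γ') := by
    rw [IsPrimitiveGenusOne, hg, hr, hz, hp]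
    tauto
  refine ⟨hiff, fun h => ?_⟩
  have hred := (hiff.2 h).2.1
  have hzk := (hiff.2 h).2.2
  have e1 := backPointCount_add_zPerm hred.apply_ne
  have e2 := card_antiexcedances hn hred.apply_ne
  have e3 := h.1.card_excedances hm
  have e4 := (h.1.zPerm_eq h.2.1).1
  have e5 := card_excedances_inv ((finRotate m * γ')⁻¹ * finRotate m)
  have e6 := card_descents_extend hι h1 h2
  rw [dual_eq_inv, inv_inv] at e5
  rw [dual_eq_inv] at e3
  rw [inv_mul_cancel_left] at e2
  have e7 := h.2.2
  omega

lemma card_reduced (n k j : ℕ) (hk : 1 ≤ k) :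
    Nat.card {α : Perm (Fin n) //
      IsGenusOne α ∧ IsReducedPerm α ∧ backPointCount α = j ∧ zPerm α = k} =
    n.choose (2 * k + j) * Nat.card {α : Perm (Fin (2 * k + j)) //
      IsPrimitiveGenusOne (2 * k + j) k α} := by
  classical
  set m := 2 * k + j with hmdef
  have hm : 0 < m := by omega
  have hchoose : Nat.card {S : Finset (Fin n) // S.card = m} = n.choose m := by
    rw [Nat.card_eq_fintype_card, Fintype.card_finset_len, Fintype.card_fin]
  rw [← hchoose, ← Nat.card_prod]
  symm
  let e : ∀ S : {S : Finset (Fin n) // S.card = m}, Fin m ≃o S.1 := fun S =>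
    S.1.orderIsoOfFin S.2
  let ext : {S : Finset (Fin n) // S.card = m} → Perm (Fin m) → Perm (Fin n) := fun S α =>
    ((finRotate m)⁻¹ * α).extendDomain (e S).toEquiv
  have hmono : ∀ S, StrictMono fun i => (e S i : Fin n) := fun S i j h => (e S).strictMono h
  have hrange : ∀ S x, x ∉ Set.range (fun i => (e S i : Fin n)) ↔ x ∉ S.1 := by
    refine fun S x => not_congr ⟨?_, fun hx => ⟨(e S).symm ⟨x, hx⟩, by simp⟩⟩
    rintro ⟨i, rfl⟩
    exact (e S i).2
  have hext1 : ∀ S α i, ext S α (e S i) = e S (((finRotate m)⁻¹ * α) i) := fun S α i =>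
    Perm.extendDomain_apply_image _ _ _
  have hext2 : ∀ S α x, x ∉ S.1 → ext S α x = x := fun S α x hx =>
    Perm.extendDomain_apply_not_subtype _ _ hx
  have hder : ∀ α : Perm (Fin m), IsPrimitivePerm α → ∀ i, ((finRotate m)⁻¹ * α) i ≠ i := by
    intro α hα i hi
    rw [Perm.mul_apply, Perm.inv_eq_iff_eq] at hi
    exact hα.2 i hi
  have key : ∀ S α, IsPrimitiveGenusOne m k α →
      IsGenusOne (finRotate n * ext S α) ∧ IsReducedPerm (finRotate n * ext S α) ∧
      backPointCount (finRotate n * ext S α) = j ∧ zPerm (finRotate n * ext S α) = k := by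
    intro S α hα
    have h := reduced_iff_primitive (hmono S) hm (hext1 S α)
      (fun x hx => hext2 S α x ((hrange S x).1 hx)) (hder α hα.1) k
    rw [mul_inv_cancel_left] at h
    obtain ⟨a, b, c⟩ := h.1.2 hα
    exact ⟨a, b, by have := h.2 hα; omega, c⟩
  have hmem : ∀ S α, IsPrimitivePerm α → ∀ x,
      x ∈ S.1 ↔ (finRotate n * ext S α) x ≠ finRotate n x := by
    intro S α hα x
    rw [Perm.mul_apply, (finRotate n).injective.ne_iff]
    refine ⟨fun hx => ?_, fun h => by_contra fun hx => h (hext2 S α x hx)⟩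
    obtain ⟨i, hi⟩ := (e S).surjective ⟨x, hx⟩
    have hi' : (e S i : Fin n) = x := congrArg Subtype.val hi
    rw [← hi', hext1]
    exact fun h => hder α hα i ((hmono S).injective h)
  refine Nat.card_congr (Equiv.ofBijective
    (fun p : {S : Finset (Fin n) // S.card = m} × {α // IsPrimitiveGenusOne m k α} =>
      (⟨finRotate n * ext p.1 p.2.1, key p.1 p.2.1 p.2.2⟩ : {α : Perm (Fin n) //
        IsGenusOne α ∧ IsReducedPerm α ∧ backPointCount α = j ∧ zPerm α = k})) ⟨?_, ?_⟩)
  · rintro ⟨S, α, hα⟩ ⟨T, δ, hδ⟩ h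
    have h' : finRotate n * ext S α = finRotate n * ext T δ := congrArg Subtype.val h
    obtain rfl : S = T := by
      refine Subtype.ext (Finset.ext fun x => ?_)
      rw [hmem S α hα.1, hmem T δ hδ.1, h']
    obtain rfl : α = δ := by
      refine Equiv.ext fun i => (finRotate m)⁻¹.injective ((hmono S).injective ?_)
      have := hext1 S α i
      rw [mul_left_cancel h', hext1] at this
      exact this.symm
    rfl
  · rintro ⟨α, hg, hr, hb, hz⟩
    obtain ⟨γ, rfl⟩ : ∃ γ, α = finRotate n * γ := ⟨_, (mul_inv_cancel_left _ _).symm⟩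
    let S : Finset (Fin n) := {x | γ x ≠ x}
    have hS : ∀ x, x ∈ S ↔ γ x ≠ x := by simp [S]
    have hSγ : ∀ x, γ x ∈ S ↔ x ∈ S := fun x => by
      rw [hS, hS, γ.injective.ne_iff]
    let f := S.orderIsoOfFin rfl
    let γ' : Perm (Fin S.card) := f.toEquiv.permCongr.symm (γ.subtypePerm hSγ)
    have h1 : ∀ i, γ (f i) = f (γ' i) := by
      intro i
      simp [γ']
    have hfm : StrictMono fun i => (f i : Fin n) := fun i j h => f.strictMono h
    have h2 : ∀ x, x ∉ Set.range (fun i => (f i : Fin n)) → γ x = x := by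
      intro x hx
      by_contra hne
      exact hx ⟨f.symm ⟨x, (hS x).2 hne⟩, by simp⟩
    have h3 : ∀ i, γ' i ≠ i := by
      intro i hi
      have := h1 i
      rw [hi] at this
      exact (hS _).1 (f i).2 this
    have hpos : 0 < S.card := by
      refine Finset.card_pos.2 (nonempty_iff_ne_empty.2 fun hem => ?_)
      have : γ = 1 := Equiv.ext fun x => by_contra fun hx => by
        have := (hS x).2 hx
        simp [hem] at this
      rw [this, mul_one] at hg
      exact not_isGenusOne_finRotate hg
    have h := reduced_iff_primitive hfm hpos h1 h2 h3 k
    have hprim := h.1.1 ⟨hg, hr, hz⟩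
    have hcard : S.card = m := by have := h.2 hprim; omega
    clear_value m
    subst hcard
    refine ⟨⟨⟨S, rfl⟩, ⟨_, hprim⟩⟩, Subtype.ext ?_⟩
    refine congrArg (finRotate n * ·) (Equiv.ext fun x => ?_)
    by_cases hx : x ∈ S
    · obtain ⟨i, hi⟩ := f.surjective ⟨x, hx⟩
      have hi' : (f i : Fin n) = x := congrArg Subtype.val hi
      rw [← hi', h1]
      refine (hext1 ⟨S, rfl⟩ _ i).trans ?_
      rw [inv_mul_cancel_left]
    · rw [hext2 ⟨S, rfl⟩ _ x hx]
      exact (by_contra fun h => hx ((hS x).2 fun h' => h h'.symm))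

end ReducedCount

section Rotation

open Equiv Finset

variable {n : ℕ}

/-- The size of the cycle of `α` containing `i`. -/
noncomputable def cycleSize (α : Perm (Fin n)) (i : Fin n) : ℕ :=
  Nat.card {j // α.SameCycle i j}

lemma cycleSize_conj (σ α : Perm (Fin n)) (i : Fin n) :
    cycleSize (σ * α * σ⁻¹) (σ i) = cycleSize α i := by
  refine Nat.card_congr (σ.subtypeEquiv fun j => ?_).symm
  rw [Perm.sameCycle_conj, perm_inv_apply, perm_inv_apply]

lemma cycleSize_eq_card {α : Perm (Fin n)} {i : Fin n} {s : Finset (Fin n)} (hi : i ∈ s)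
    (hs : ∀ j ∈ s, α j ∈ s) (h : ∀ j ∈ s, α.SameCycle i j) : cycleSize α i = s.card := by
  classical
  rw [cycleSize, Nat.card_eq_fintype_card, Fintype.card_subtype]
  congr 1
  ext j
  refine ⟨fun hj => ?_, fun hj => mem_filter.2 ⟨mem_univ _, h j hj⟩⟩
  obtain ⟨t, -, rfl⟩ := (mem_filter.1 hj).2.exists_pow_eq'
  clear hj
  induction t with
  | zero => exact hi
  | succ t ih =>
    rw [pow_succ', Perm.mul_apply]
    exact hs _ ih

lemma sum_inv_cycleSize (α : Perm (Fin n)) :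
    ∑ i, (1 : ℚ) / cycleSize α i = zPerm α := by
  classical
  have : Fintype (Quotient (cycleSetoid α)) := Fintype.ofFinite _
  let q : Fin n → Quotient (cycleSetoid α) := Quotient.mk _
  have hq : ∀ i j, q i = q j ↔ α.SameCycle i j := fun i j =>
    ⟨fun h => Quotient.exact h, fun h => Quotient.sound (s := cycleSetoid α) h⟩
  have hL : ∀ i, cycleSize α i = #{j | q j = q i} := fun i => by
    rw [cycleSize, Nat.card_eq_fintype_card, Fintype.card_subtype]
    congr 1
    ext j
    simp only [mem_filter, mem_univ, true_and, hq]
    exact Perm.sameCycle_comm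
  rw [← sum_fiberwise univ q, zPerm, Nat.card_eq_fintype_card, ← card_univ, card_eq_sum_ones,
    Nat.cast_sum]
  refine sum_congr rfl fun x _ => ?_
  obtain ⟨i, rfl⟩ : ∃ i, q i = x := Quotient.exists_rep x
  have hpos : 0 < #{j | q j = q i} := card_pos.2 ⟨i, by simp⟩
  rw [sum_congr rfl (g := fun _ => (1 : ℚ) / #{j | q j = q i})]
  · rw [sum_const, nsmul_eq_mul, mul_one_div_cancel (by positivity), Nat.cast_one]
  · intro j hj
    rw [hL, (mem_filter.1 hj).2]

lemma IsPrimitiveGenusOne.conj {m k : ℕ} {α σ : Perm (Fin m)} (hσ : Commute σ (finRotate m))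
    (h : IsPrimitiveGenusOne m k α) : IsPrimitiveGenusOne m k (σ * α * σ⁻¹) := by
  have hd : (σ * α * σ⁻¹)⁻¹ * finRotate m = σ * (α⁻¹ * finRotate m) * σ⁻¹ := by
    have := hσ.inv_left.eq
    rw [mul_inv_rev, mul_inv_rev, inv_inv]
    simp only [mul_assoc]
    rw [this]
  refine ⟨⟨fun i hi => ?_, fun i hi => ?_⟩, ?_, ?_⟩
  · exact h.1.1 (σ⁻¹ i) (by
      rw [Perm.eq_inv_iff_eq]; exact hi)
  · refine h.1.2 (σ⁻¹ i) ?_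
    have h2 : finRotate m (σ⁻¹ i) = σ⁻¹ (finRotate m i) := by
      rw [← Perm.mul_apply, ← Perm.mul_apply, hσ.inv_left.eq]
    rw [h2, Perm.eq_inv_iff_eq]
    exact hi
  · rw [IsGenusOne, hd, zPerm_conj, zPerm_conj]
    exact h.2.1
  · rw [zPerm_conj]
    exact h.2.2

open Classical in
/-- Averaging over rotations: primitive permutations can be counted by looking only at the
cycle of `0`. -/
lemma card_primitive_eq_sum_cycleSize {m k : ℕ} (hm : 0 < m) :
    ((m : ℚ) - 2 * k) * #{α : Perm (Fin m) | IsPrimitiveGenusOne m k α} =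
      m * ∑ α : Perm (Fin m) with IsPrimitiveGenusOne m k α,
        (1 - 2 / (cycleSize α ⟨0, hm⟩ : ℚ)) := by
  have h1 : ∀ α ∈ univ.filter (IsPrimitiveGenusOne m k),
      ∑ i, (1 - 2 / (cycleSize α i : ℚ)) = (m : ℚ) - 2 * k := by
    intro α hα
    have := sum_inv_cycleSize α
    rw [(mem_filter.1 hα).2.2.2] at this
    rw [sum_sub_distrib, ← this, mul_sum]
    simp [div_eq_mul_inv]
  have h2 : ∀ i : Fin m, ∑ α with IsPrimitiveGenusOne m k α, (1 - 2 / (cycleSize α i : ℚ)) =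
      ∑ α with IsPrimitiveGenusOne m k α, (1 - 2 / (cycleSize α ⟨0, hm⟩ : ℚ)) := by
    intro i
    obtain ⟨t, -, ht⟩ := exists_finRotate_pow i ⟨0, hm⟩
    set σ := finRotate m ^ t
    have hσ : Commute σ (finRotate m) := (Commute.refl _).pow_left t
    refine sum_bij (fun α _ => σ * α * σ⁻¹) (fun α hα => ?_) (fun α _ β _ h => ?_)
      (fun α hα => ⟨σ⁻¹ * α * σ⁻¹⁻¹, ?_, ?_⟩) (fun α _ => ?_)
    · exact mem_filter.2 ⟨mem_univ _, (mem_filter.1 hα).2.conj hσ⟩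
    · exact mul_left_cancel (mul_right_cancel h)
    · exact mem_filter.2 ⟨mem_univ _, (mem_filter.1 hα).2.conj hσ.inv_left⟩
    · group
    · rw [← ht, cycleSize_conj]
  rw [mul_comm, ← nsmul_eq_mul, ← sum_const, ← sum_congr rfl h1, sum_comm,
    sum_congr rfl fun i _ => h2 i, sum_const, card_univ, Fintype.card_fin, nsmul_eq_mul]

end Rotation

section Runs

/-- The function on `{0,…,k}` with three decreasing runs, starting at `0`, `u + 1` and `y`. -/
def threeRuns (k u y i : ℕ) : ℕ :=
  if i ≤ u then k + 1 + u - i else if i < y then k + 1 + u + y - i else 2 * k + 1 + y - i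

lemma add_eq_add_of_descending {f : ℕ → ℕ} {p q : ℕ}
    (h : ∀ i, p ≤ i → i < q → f i = f (i + 1) + 1) {i : ℕ} (hp : p ≤ i) (hq : i ≤ q) :
    f i + i = f p + p := by
  induction i, hp using Nat.le_induction with
  | base => rfl
  | succ i hi ih => have := h i hi hq; have := ih (by omega); omega

/-- A bijection `{0,…,k} → {k+1,…,2k+1}` decreasing in unit steps except at the places forced
by its extreme values. -/
lemma eq_threeRuns {k u y : ℕ} {f : ℕ → ℕ} (hlo : ∀ i ≤ k, k + 1 ≤ f i)
    (hhi : ∀ i ≤ k, f i ≤ 2 * k + 1) (hinj : ∀ i ≤ k, ∀ j ≤ k, f i = f j → i = j)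
    (hu : u ≤ k) (hfu : f u = k + 1) (hy : y ≤ k) (hfy : f y = 2 * k + 1) (hy0 : y ≠ 0)
    (hstep : ∀ i < k, i ≠ u → i + 1 ≠ y → f i = f (i + 1) + 1) :
    u < y ∧ ∀ i ≤ k, f i = threeRuns k u y i := by
  have huy : u < y := by
    by_contra hle
    have := add_eq_add_of_descending (f := f) (p := y) (q := u)
      (fun i h1 h2 => hstep i (by omega) (by omega) (by omega)) (i := u) (by omega) le_rfl
    omega
  have h1 : ∀ i ≤ u, f i + i = k + 1 + u := fun i hi => by
    have h := fun i hi => add_eq_add_of_descending (f := f) (p := 0) (q := u)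
      (fun i h1 h2 => hstep i (by omega) (by omega) (by omega)) (i := i) (by omega) hi
    have := h i hi
    have := h u le_rfl
    omega
  have h3 : ∀ i ≤ k, y ≤ i → f i + i = 2 * k + 1 + y := fun i hi hyi => by
    have := add_eq_add_of_descending (f := f) (p := y) (q := k)
      (fun i h1 h2 => hstep i (by omega) (by omega) (by omega)) hyi hi
    omega
  have h2 : ∀ i, u + 1 ≤ i → i ≤ y - 1 → f i + i = f (u + 1) + (u + 1) := fun i hi hyi =>
    add_eq_add_of_descending (f := f) (p := u + 1) (q := y - 1)
      (fun i h1 h2 => hstep i (by omega) (by omega) (by omega)) hi hyi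
  refine ⟨huy, fun i hi => ?_⟩
  unfold threeRuns
  split_ifs with h h'
  · have := h1 i h; omega
  · have e1 := h2 i (by omega) (by omega)
    have e2 := h2 (y - 1) (by omega) (by omega)
    have e3 := hlo (y - 1) (by omega)
    have e4 := hhi (u + 1) (by omega)
    have e5 : k + u + 2 ≤ f (y - 1) := by
      by_contra hlt
      have := h1 (k + 1 + u - f (y - 1)) (by omega)
      have := hinj (k + 1 + u - f (y - 1)) (by omega) (y - 1) (by omega) (by omega)
      omega
    have e6 : f (u + 1) ≤ k + y := by
      by_contra hlt
      have := h3 (2 * k + 1 + y - f (u + 1)) (by omega) (by omega)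
      have := hinj (2 * k + 1 + y - f (u + 1)) (by omega) (u + 1) (by omega) (by omega)
      omega
    omega
  · have := h3 i hi (by omega); omega

end Runs

section Classification

open Finset

/-- Numerical data carried by a primitive permutation `a` of `{0,…,m-1}` of genus one with `k`
cycles and its dual `b`. -/
structure IsPrimitivePair (m k : ℕ) (a b : ℕ → ℕ) : Prop where
  a_lt : ∀ i < m, a i < m
  b_lt : ∀ i < m, b i < m
  a_inj : ∀ i < m, ∀ j < m, a i = a j → i = j
  b_inj : ∀ i < m, ∀ j < m, b i = b j → i = j
  a_b : ∀ i < m, a (b i) = if i + 1 = m then 0 else i + 1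
  a_ne : ∀ i < m, a i ≠ i
  b_ne : ∀ i < m, b i ≠ i
  a_unique : ∀ i < m, ∀ t, i < a i → a^[t] i < a (a^[t] i) → a^[t] i = i
  b_unique : ∀ i < m, ∀ t, i < b i → b^[t] i < b (b^[t] i) → b^[t] i = i
  card_a : #{i ∈ range m | i < a i} = k
  card_b : #{i ∈ range m | i < b i} + k + 1 = m

namespace IsPrimitivePair

variable {m k : ℕ} {a b : ℕ → ℕ}

lemma pos (h : IsPrimitivePair m k a b) : 0 < m := by have := h.card_b; omega

lemma zero_lt (h : IsPrimitivePair m k a b) : 0 < a 0 :=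
  Nat.pos_of_ne_zero (h.a_ne 0 h.pos)

/-- The only excedance in the cycle of `0` is `0`. -/
lemma eq_zero_of_iterate (h : IsPrimitivePair m k a b) {i t : ℕ} (hi : i < m) (hia : i < a i)
    (ht : a^[t] i = 0) : i = 0 := by
  have := h.a_unique i hi t hia (by rw [ht]; exact h.zero_lt)
  omega

lemma apply_apply_lt (h : IsPrimitivePair m k a b) {i : ℕ} (hi : i < m) (hia : i < a i) :
    a (a i) < a i := by
  have h1 := h.a_ne (a i) (h.a_lt i hi)
  have h2 := h.a_unique i hi 1 hia
  simp only [Function.iterate_one] at h2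
  omega

/-- The successor of a non-excedance not mapped to `0` is the image of an excedance. -/
lemma exists_of_not_excedance (h : IsPrimitivePair m k a b) {j : ℕ} (hj : j + 1 < m)
    (hja : a j < j) (h0 : a j ≠ 0) : ∃ i < j + 1, a i = j + 1 := by
  have hb := h.a_b (a j - 1) (by omega)
  rw [if_neg (by omega)] at hb
  have hbj : b (a j - 1) = j := h.a_inj _ (h.b_lt _ (by omega)) _ (by omega) (by omega)
  have h1 := h.b_ne j (by omega)
  have h2 := h.b_unique (a j - 1) (by omega) 1 (by omega)
  simp only [Function.iterate_one, hbj] at h2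
  have h3 := h.a_b j (by omega)
  rw [if_neg (by omega)] at h3
  exact ⟨b j, by omega, h3⟩

lemma apply_apply_ne_zero (h : IsPrimitivePair m k a b) (h0 : a (a 0) ≠ 0) {i : ℕ} (hi : i < m)
    (hia : i < a i) : a (a i) ≠ 0 := by
  intro hz
  have := h.eq_zero_of_iterate (t := 2) hi hia hz
  subst this
  exact h0 hz

/-- The images of the excedances are the `k` largest points. -/
lemma excedance_image (h : IsPrimitivePair m k a b) (h0 : a (a 0) ≠ 0) :
    (∀ v, m - k ≤ v → v < m → ∃ i < v, a i = v) ∧ ∀ i < m, i < a i → m - k ≤ a i := by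
  set V := {i ∈ range m | i < a i}.image a with hV
  have hmem : ∀ v, v ∈ V ↔ v < m ∧ ∃ i < v, a i = v := by
    intro v
    simp only [hV, mem_image, mem_filter, mem_range]
    constructor
    · rintro ⟨i, ⟨hi, hia⟩, rfl⟩
      exact ⟨h.a_lt i hi, i, hia, rfl⟩
    · rintro ⟨hv, i, hi, rfl⟩
      exact ⟨i, ⟨by omega, hi⟩, rfl⟩
  have hcard : V.card = k := by
    rw [hV, card_image_of_injOn, h.card_a]
    intro i hi j hj hij
    simp only [coe_filter, mem_range, Set.mem_ofPred_eq] at hi hj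
    exact h.a_inj i hi.1 j hj.1 hij
  have hup : ∀ v, v ∈ V → v + 1 < m → v + 1 ∈ V := by
    intro v hv hvm
    obtain ⟨-, i, hi, rfl⟩ := (hmem v).1 hv
    refine (hmem _).2 ⟨hvm, h.exists_of_not_excedance hvm ?_ ?_⟩
    · exact h.apply_apply_lt (by omega) hi
    · exact h.apply_apply_ne_zero h0 (by omega) hi
  have hIco : ∀ v ∈ V, Ico v m ⊆ V := by
    intro v hv x hx
    obtain ⟨h1, h2⟩ := mem_Ico.1 hx
    clear hx
    induction x, h1 using Nat.le_induction with
    | base => exact hv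
    | succ x hx ih => exact hup x (ih (by omega)) h2
  have hsub : V ⊆ Ico (m - k) m := by
    intro v hv
    have := card_le_card (hIco v hv)
    rw [Nat.card_Ico, hcard] at this
    exact mem_Ico.2 ⟨by omega, ((hmem v).1 hv).1⟩
  have heq := eq_of_subset_of_card_le hsub (by rw [Nat.card_Ico, hcard]; omega)
  refine ⟨fun v h1 h2 => ?_, fun i hi hia => ?_⟩
  · exact ((hmem v).1 (heq ▸ mem_Ico.2 ⟨h1, h2⟩)).2
  · exact (mem_Ico.1 (hsub ((hmem _).2 ⟨h.a_lt i hi, i, hia, rfl⟩))).1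

lemma apply_lt_of_le (h : IsPrimitivePair m k a b) (h0 : a (a 0) ≠ 0) {v : ℕ}
    (hv : m - k ≤ v) (hvm : v < m) : a v < m - k ∧ a v ≠ 0 := by
  obtain ⟨i, hi, rfl⟩ := (h.excedance_image h0).1 v hv hvm
  refine ⟨?_, h.apply_apply_ne_zero h0 (by omega) hi⟩
  by_contra hlt
  have h1 := h.apply_apply_lt (by omega) hi
  obtain ⟨j, hj, hji⟩ := (h.excedance_image h0).1 (a (a i)) (by omega) (by omega)
  have := h.a_inj j (by omega) (a i) hvm hji
  omega

/-- The preimage of `0` and the set of excedances. -/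
lemma exists_apply_eq_zero (h : IsPrimitivePair m k a b) (h0 : a (a 0) ≠ 0) :
    ∃ y, a y = 0 ∧ y ≠ 0 ∧ y < m - k := by
  have hm := h.pos
  have hb := h.a_b (m - 1) (by omega)
  rw [if_pos (by omega)] at hb
  refine ⟨b (m - 1), hb, fun hz => ?_, ?_⟩
  · exact h.a_ne 0 h.pos (by rw [hz] at hb; exact hb)
  · by_contra hlt
    exact (h.apply_lt_of_le h0 (by omega) (h.b_lt _ (by omega))).2 hb

lemma excedances_subset (h : IsPrimitivePair m k a b) (h0 : a (a 0) ≠ 0) {y : ℕ}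
    (hy : a y = 0) : {i ∈ range m | i < a i} ⊆ (range (m - k)).erase y := by
  intro i hi
  simp only [mem_filter, mem_range, mem_erase] at hi ⊢
  refine ⟨by rintro rfl; omega, ?_⟩
  by_contra hlt
  have := h.apply_lt_of_le h0 (by omega) hi.1
  omega

/-- Classification when there is one back point. -/
lemma eq_threeRuns_of_one (h : IsPrimitivePair (2 * k + 1) k a b) (h0 : a (a 0) ≠ 0) :
    ∃ u y, u < y ∧ y ≤ k ∧ a y = 0 ∧ (∀ i ≤ k, i ≠ y → a i = threeRuns k u y i) ∧
      (∀ i ≤ k, i ≠ y → a (a i) = if i = 0 then y else i) := by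
  obtain ⟨y, hay, hy0, hyk⟩ := h.exists_apply_eq_zero h0
  obtain ⟨hV, hVU⟩ := h.excedance_image h0
  have hbig : ∀ v, k + 1 ≤ v → v < 2 * k + 1 → a v < k + 1 ∧ a v ≠ 0 := fun v h1 h2 => by
    have := h.apply_lt_of_le h0 (v := v) (by omega) h2
    omega
  have hU : ∀ i ≤ k, i ≠ y → i < a i := by
    have hsub := h.excedances_subset h0 hay
    have := eq_of_subset_of_card_le hsub (by
      rw [card_erase_of_mem (mem_range.2 hyk), card_range, h.card_a]; omega)
    intro i hi hiy
    have hmem : i ∈ (range (2 * k + 1 - k)).erase y :=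
      mem_erase.2 ⟨hiy, mem_range.2 (by omega)⟩
    rw [← this] at hmem
    exact (mem_filter.1 hmem).2
  have haa : ∀ i ≤ k, i ≠ y → a (a i) = if i = 0 then y else i := by
    intro i hi hiy
    have h1 := hU i hi hiy
    have h2 := hVU i (by omega) h1
    have h3 := hbig (a i) (by omega) (h.a_lt i (by omega))
    by_cases hyi : a (a i) = y
    · have := h.eq_zero_of_iterate (i := i) (t := 3) (by omega) h1 (by simp [hyi, hay])
      rw [if_pos this, hyi]
    · have h4 := h.a_unique i (by omega) 2 h1 (by simpa using hU (a (a i)) (by omega) hyi)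
      simp only [Function.iterate_succ, Function.iterate_zero, Function.comp, id] at h4
      rw [if_neg, h4]
      rintro rfl
      exact h0 h4
  have hk : 0 < k := by omega
  obtain ⟨u, huk, hau⟩ := hV (k + 1) (by omega) (by omega)
  have huy : u ≠ y := by rintro rfl; omega
  let f : ℕ → ℕ := fun i => if i = y then 2 * k + 1 else a i
  have hfy : f y = 2 * k + 1 := if_pos rfl
  have hf : ∀ i, i ≠ y → f i = a i := fun i hi => if_neg hi
  have hlt : ∀ i ≤ k, i ≠ y → k + 1 ≤ a i ∧ a i ≤ 2 * k := fun i hi hiy => by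
    have := hVU i (by omega) (hU i hi hiy)
    have := h.a_lt i (by omega)
    omega
  have hpre : ∀ v, k + 1 ≤ v → v ≤ 2 * k → ∀ i < 2 * k + 1, a i = v → i ≤ k ∧ i ≠ y := by
    intro v h1 h2 i hi hiv
    refine ⟨?_, by rintro rfl; omega⟩
    by_contra hlt
    have := hbig i (by omega) hi
    omega
  have hbexc : ∀ x < k, k + 1 ≤ b x := by
    intro x hx
    have hb := h.a_b x (by omega)
    rw [if_neg (by omega)] at hb
    by_contra hlt'
    by_cases hxy : b x = y
    · rw [hxy] at hb; omega
    · have := hlt (b x) (by omega) hxy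
      omega
  suffices hrun : u < y ∧ ∀ i ≤ k, f i = threeRuns k u y i from
    ⟨u, y, hrun.1, by omega, hay, fun i hi hiy => by rw [← hrun.2 i hi, hf i hiy], haa⟩
  refine eq_threeRuns (fun i hi => ?_) (fun i hi => ?_) (fun i hi j hj hij => ?_) (by omega)
    (by rw [hf u huy, hau]) (by omega) hfy hy0 (fun i hi hiu hiy => ?_)
  · by_cases hiy : i = y
    · rw [hiy, hfy]; omega
    · rw [hf i hiy]; exact (hlt i hi hiy).1
  · by_cases hiy : i = y
    · rw [hiy, hfy]
    · rw [hf i hiy]; have := (hlt i hi hiy).2; omega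
  · by_cases hiy : i = y <;> by_cases hjy : j = y
    · rw [hiy, hjy]
    · have := hlt j hj hjy
      rw [hiy, hfy, hf j hjy] at hij; omega
    · have := hlt i hi hiy
      rw [hjy, hfy, hf i hiy] at hij; omega
    · rw [hf i hiy, hf j hjy] at hij
      exact h.a_inj i (by omega) j (by omega) hij
  · rw [hf (i + 1) hiy]
    set j := a (i + 1) with hj
    have hjlt := hlt (i + 1) (by omega) hiy
    have haj := haa (i + 1) (by omega) hiy
    rw [if_neg (by omega), ← hj] at haj
    have hbi := h.a_b i (by omega)
    rw [if_neg (by omega)] at hbi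
    have hbij : b i = j := h.a_inj _ (h.b_lt i (by omega)) _ (by omega) (by omega)
    have hbj := h.a_b j (by omega)
    have hfb : b j ≤ k ∧ f (b j) = j + 1 := by
      split_ifs at hbj with hjm
      · have : b j = y := h.a_inj _ (h.b_lt j (by omega)) _ (by omega) (by omega)
        rw [this, hfy]; omega
      · have := hpre (j + 1) (by omega) (by omega) (b j) (h.b_lt j (by omega)) hbj
        rw [hf _ this.2]; omega
    have hbjk : b j ≠ k := by
      intro hjk
      have h1 := h.a_b k (by omega)
      rw [if_neg (by omega)] at h1
      have hbk : b k = u := h.a_inj _ (h.b_lt k (by omega)) _ (by omega) (by omega)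
      have h2 := h.b_ne k (by omega)
      have h3 := hbexc u (by omega)
      have h4 := h.b_unique i (by omega) 3 (by omega)
      simp only [Function.iterate_succ, Function.iterate_zero, Function.comp, id, hbij, hjk,
        hbk] at h4
      omega
    have h4 := h.b_unique i (by omega) 2 (by omega)
    simp only [Function.iterate_succ, Function.iterate_zero, Function.comp, id, hbij] at h4
    have h5 := hbexc (b j) (by omega)
    rw [← h4 (by omega), hfb.2]

/-- Classification when there are two back points. -/
lemma eq_threeRuns_of_two (h : IsPrimitivePair (2 * k + 2) k a b) (h0 : a (a 0) ≠ 0) :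
    ∃ u y, u < y ∧ y ≤ k ∧ (∀ i ≤ k, b i = threeRuns k u y i) ∧
      (∀ i ≤ k, b (b i) = i) := by
  obtain ⟨y, hay, hy0, hyk⟩ := h.exists_apply_eq_zero h0
  obtain ⟨hV, hVU⟩ := h.excedance_image h0
  have hbig : ∀ v, k + 2 ≤ v → v < 2 * k + 2 → a v < k + 2 ∧ a v ≠ 0 := fun v h1 h2 => by
    have := h.apply_lt_of_le h0 (v := v) (by omega) h2
    omega
  have hab : ∀ i ≤ 2 * k, a (b i) = i + 1 := fun i hi => by
    rw [h.a_b i (by omega), if_neg (by omega)]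
  have hsub := h.excedances_subset h0 hay
  have hcard : ((range (2 * k + 2 - k)).erase y).card = k + 1 := by
    rw [card_erase_of_mem (mem_range.2 hyk), card_range]; omega
  -- the only small non-excedance besides `y` is `k + 1`
  have hnon : ∀ z < k + 2, z ≠ y → a z < z → z = k + 1 := by
    intro z hz hzy hza
    by_contra hzk
    have hz0 : a z ≠ 0 := fun h' => hzy (h.a_inj z (by omega) y (by omega) (by omega))
    obtain ⟨i, hi, hiz⟩ := h.exists_of_not_excedance (j := z) (by omega) hza hz0
    have := hVU i (by omega) (by omega)
    omega
  have hex : ∃ z < k + 2, z ≠ y ∧ a z < z := by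
    by_contra! hall
    have : (range (2 * k + 2 - k)).erase y ⊆ {i ∈ range (2 * k + 2) | i < a i} := by
      intro i hi
      simp only [mem_filter, mem_range, mem_erase] at hi ⊢
      have h1 := hall i (by omega) hi.1
      have h2 := h.a_ne i (by omega)
      omega
    have := card_le_card this
    rw [hcard, h.card_a] at this
    omega
  obtain ⟨z, hz, hzy, hza⟩ := hex
  obtain rfl := hnon z hz hzy hza
  have hyk' : y ≤ k := by omega
  have hU : ∀ i ≤ k, i ≠ y → i < a i := by
    intro i hi hiy
    have h1 := h.a_ne i (by omega)
    by_contra hlt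
    have := hnon i (by omega) hiy (by omega)
    omega
  have hlt : ∀ i ≤ k, i ≠ y → k + 2 ≤ a i ∧ a i ≤ 2 * k + 1 := fun i hi hiy => by
    have := hVU i (by omega) (hU i hi hiy)
    have := h.a_lt i (by omega)
    omega
  have hbup : ∀ i ≤ k, k + 1 ≤ b i := by
    intro i hi
    by_contra hlt'
    have h1 := h.a_b i (by omega)
    rw [if_neg (by omega)] at h1
    by_cases hiy : b i = y
    · rw [hiy] at h1; omega
    · have := hlt (b i) (by omega) hiy; omega
  have hbdown : ∀ i, k + 1 ≤ i → i < 2 * k + 2 → b i ≤ k := by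
    have himg : (range (k + 1)).image b = Ico (k + 1) (2 * k + 2) := by
      refine eq_of_subset_of_card_le (fun x hx => ?_) ?_
      · obtain ⟨i, hi, rfl⟩ := mem_image.1 hx
        have := mem_range.1 hi
        exact mem_Ico.2 ⟨hbup i (by omega), h.b_lt i (by omega)⟩
      · rw [card_image_of_injOn, Nat.card_Ico, card_range]
        · omega
        · intro i hi j hj hij
          simp only [coe_range, Set.mem_Iio] at hi hj
          exact h.b_inj i (by omega) j (by omega) hij
    intro i h1 h2
    by_contra hlt'
    have hmem : b i ∈ (range (k + 1)).image b := by
      rw [himg]; exact mem_Ico.2 ⟨by omega, h.b_lt i h2⟩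
    obtain ⟨j, hj, hji⟩ := mem_image.1 hmem
    have := h.b_inj j (by have := mem_range.1 hj; omega) i h2 hji
    have := mem_range.1 hj
    omega
  have hbb : ∀ i ≤ k, b (b i) = i := by
    intro i hi
    have h1 := hbup i hi
    have h2 := hbdown (b i) h1 (h.b_lt i (by omega))
    have h3 := hbup (b (b i)) h2
    have h4 := h.b_unique i (by omega) 2 (by omega)
    simp only [Function.iterate_succ, Function.iterate_zero, Function.comp, id] at h4
    exact h4 (by omega)
  have hbb' : ∀ i, i < 2 * k + 2 → b (b i) = i := by
    intro i hi
    by_cases hik : i ≤ k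
    · exact hbb i hik
    · have := hbdown i (by omega) hi
      exact h.b_inj _ (h.b_lt _ (by omega)) _ hi (hbb _ this)
  have hby : b y = 2 * k + 1 := by
    have h1 := h.a_b (2 * k + 1) (by omega)
    rw [if_pos rfl] at h1
    have : b (2 * k + 1) = y := h.a_inj _ (h.b_lt _ (by omega)) _ (by omega) (by omega)
    rw [← this, hbb' _ (by omega)]
  have hk1 := hbdown (k + 1) le_rfl (by omega)
  set u := b (k + 1) with hu
  have hbu : b u = k + 1 := hbb' _ (by omega)
  suffices hrun : u < y ∧ ∀ i ≤ k, b i = threeRuns k u y i from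
    ⟨u, y, hrun.1, hyk', hrun.2, hbb⟩
  refine eq_threeRuns hbup (fun i hi => by have := h.b_lt i (by omega); omega)
    (fun i hi j hj => h.b_inj i (by omega) j (by omega)) hk1 hbu hyk' hby hy0
    (fun i hi hiu hiy => ?_)
  have hw := hU (i + 1) (by omega) hiy
  have hbw : b (i + 1) ≠ 2 * k + 1 := by
    intro h'
    exact hiy (h.b_inj _ (by omega) y (by omega) (by omega))
  have h1 := hbup (i + 1) (by omega)
  have h2 := h.b_lt (i + 1) (by omega)
  have haw : a (i + 1) = b (i + 1) + 1 := by
    have := hab (b (i + 1)) (by omega)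
    rwa [hbb' _ (by omega)] at this
  set j := a (i + 1) with hj
  have hbj := hbdown j (by omega) (by omega)
  have haj : a j = b j + 1 := by
    have := hab (b j) (by omega)
    rwa [hbb' _ (by omega)] at this
  have hajy : a j ≠ y := by
    intro h'
    have := h.eq_zero_of_iterate (i := i + 1) (t := 3) (by omega) hw
      (by simp [← hj, h', hay])
    omega
  have hajk : a j ≠ k + 1 := by
    intro h'
    have hak : a (k + 1) = u + 1 := by
      have := hab u (by omega)
      rwa [hbu] at this
    have h3 := h.a_ne (k + 1) (by omega)
    have huy' : u + 1 ≠ y := by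
      intro h''
      have := h.eq_zero_of_iterate (i := i + 1) (t := 4) (by omega) hw
        (by simp [← hj, h', hak, h'', hay])
      omega
    have h4 := h.a_unique (i + 1) (by omega) 3 hw
    simp only [Function.iterate_succ, Function.iterate_zero, Function.comp, id, ← hj, h',
      hak] at h4
    have := h4 (hU _ (by omega) huy')
    omega
  have h4 := h.a_unique (i + 1) (by omega) 2 hw
  simp only [Function.iterate_succ, Function.iterate_zero, Function.comp, id, ← hj] at h4
  have h5 := h4 (hU _ (by omega) hajy)
  have h6 : b j = i := by omega
  rw [← haw, ← hbb' j (by omega), h6]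

end IsPrimitivePair

end Classification

section Models

open Equiv Finset

variable {m k : ℕ}

/-- A permutation of `Fin m` as a function on `ℕ`. -/
def natFun (α : Perm (Fin m)) (i : ℕ) : ℕ := if h : i < m then α ⟨i, h⟩ else i

lemma natFun_val (α : Perm (Fin m)) (i : Fin m) : natFun α i = α i := by
  simp [natFun]

lemma natFun_iterate (α : Perm (Fin m)) (t : ℕ) (i : Fin m) :
    (natFun α)^[t] i = (α ^ t) i := by
  induction t with
  | zero => rfl
  | succ t ih => rw [Function.iterate_succ_apply', ih, natFun_val, pow_succ', Perm.mul_apply]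

lemma natFun_unique {α : Perm (Fin m)} (hα : ∀ i, α i ≠ i)
    (hz : zPerm α = #{i | i < α i}) (i : ℕ) (hi : i < m) (t : ℕ) (h1 : i < natFun α i)
    (h2 : (natFun α)^[t] i < natFun α ((natFun α)^[t] i)) : (natFun α)^[t] i = i := by
  lift i to Fin m using hi
  rw [natFun_iterate, natFun_val] at h2
  rw [natFun_val] at h1
  rw [natFun_iterate]
  exact congrArg Fin.val (excedance_unique hα hz h1 h2 ⟨t, by simp⟩).symm

lemma card_natFun_excedances (α : Perm (Fin m)) :
    #{i ∈ range m | i < natFun α i} = #{i : Fin m | i < α i} := by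
  rw [← card_map Fin.valEmbedding]
  congr 1
  ext i
  simp only [mem_filter, mem_range, mem_map, mem_univ, true_and, Fin.valEmbedding_apply]
  constructor
  · rintro ⟨hi, h⟩
    lift i to Fin m using hi
    exact ⟨i, by rwa [natFun_val] at h, rfl⟩
  · rintro ⟨i, hi, rfl⟩
    exact ⟨i.2, by rwa [natFun_val]⟩

lemma IsPrimitiveGenusOne.isPrimitivePair {α : Perm (Fin m)} (h : IsPrimitiveGenusOne m k α) :
    IsPrimitivePair m k (natFun α) (natFun (α⁻¹ * finRotate m)) := by
  have hm : 0 < m := by have := h.2.1; unfold IsGenusOne at this; omega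
  obtain ⟨hz1, hz2⟩ := h.1.zPerm_eq h.2.1
  have hinj : ∀ γ : Perm (Fin m), ∀ i < m, ∀ j < m, natFun γ i = natFun γ j → i = j := by
    intro γ i hi j hj hij
    simpa [natFun, hi, hj, Fin.val_inj] using hij
  have hlt : ∀ γ : Perm (Fin m), ∀ i < m, natFun γ i < m := by
    intro γ i hi
    simp [natFun, hi]
  have hne : ∀ γ : Perm (Fin m), (∀ i, γ i ≠ i) → ∀ i < m, natFun γ i ≠ i := by
    intro γ hγ i hi h
    lift i to Fin m using hi
    rw [natFun_val] at h
    exact hγ i (Fin.ext h)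
  refine ⟨hlt _, hlt _, hinj _, hinj _, fun i hi => ?_, hne _ h.1.1, hne _ h.1.dual_ne,
    natFun_unique h.1.1 hz1, natFun_unique h.1.dual_ne hz2, ?_, ?_⟩
  · lift i to Fin m using hi
    rw [natFun_val, natFun_val, Perm.mul_apply, perm_apply_inv, finRotate_val]
  · rw [card_natFun_excedances, ← hz1, h.2.2]
  · have := h.1.card_excedances hm
    rw [card_natFun_excedances, ← h.2.2, hz1]
    omega

/-- The permutation of `Fin m` given by an injective function on `{0,…,m-1}`. -/
noncomputable def permOfNat (g : ℕ → ℕ) (hlt : ∀ i < m, g i < m)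
    (hinj : ∀ i < m, ∀ j < m, g i = g j → i = j) : Perm (Fin m) :=
  Equiv.ofBijective (fun i => ⟨g i, hlt i i.2⟩) (Finite.injective_iff_bijective.1 fun i j h =>
    Fin.ext (hinj i i.2 j j.2 (congrArg Fin.val h)))

lemma isPrimitiveGenusOne_of_invariants {α : Perm (Fin m)} (hm : 0 < m) (h : IsPrimitivePerm α)
    (φ ψ : ℕ → ℕ) (hφ : ∀ i, φ (α i) = φ i) (hψ : ∀ i j, α i = finRotate m j → ψ i = ψ j)
    (s t : Finset ℕ) (hs : ∀ x ∈ s, ∃ i < m, φ i = x) (ht : ∀ x ∈ t, ∃ i < m, ψ i = x)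
    (hk : s.card = k) (hst : s.card + t.card + 1 = m) : IsPrimitiveGenusOne m k α := by
  have h1 := card_le_zPerm_of_invariant (α := α) (fun i => φ i) hφ s fun x hx => by
    obtain ⟨i, hi, h⟩ := hs x hx
    exact ⟨⟨i, hi⟩, h⟩
  have h2 := card_le_zPerm_of_invariant (α := α⁻¹ * finRotate m) (fun i => ψ i)
    (fun i => hψ _ _ (by rw [Perm.mul_apply, perm_apply_inv])) t fun x hx => by
    obtain ⟨i, hi, h⟩ := ht x hx
    exact ⟨⟨i, hi⟩, h⟩
  have h3 := h.zPerm_add_le hm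
  refine ⟨h, ?_, ?_⟩
  · unfold IsGenusOne; omega
  · omega

lemma cycleSize_eq_two {α : Perm (Fin m)} {i : Fin m} (h : α (α i) = i) (hi : α i ≠ i) :
    cycleSize α i = 2 := by
  rw [cycleSize_eq_card (s := {i, α i}), card_pair hi.symm]
  · simp
  · simp [h]
  · simp [Perm.SameCycle.refl]

lemma cycleSize_eq_three {α : Perm (Fin m)} {i j l : Fin m} (hi : α i = j) (hj : α j = l)
    (hl : α l = i) (hij : i ≠ j) (hil : i ≠ l) (hjl : j ≠ l) : cycleSize α i = 3 := by
  rw [cycleSize_eq_card (s := {i, j, l})]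
  · rw [card_insert_of_notMem, card_pair hjl]
    simp [hij, hil]
  · simp
  · simp [hi, hj, hl]
  · subst hi hj
    simp [Perm.SameCycle.refl]

lemma cycleSize_eq_four {α : Perm (Fin m)} {i j l p : Fin m} (hi : α i = j) (hj : α j = l)
    (hl : α l = p) (hp : α p = i) (hij : i ≠ j) (hil : i ≠ l) (hip : i ≠ p) (hjl : j ≠ l)
    (hjp : j ≠ p) (hlp : l ≠ p) : cycleSize α i = 4 := by
  rw [cycleSize_eq_card (s := {i, j, l, p})]
  · rw [card_insert_of_notMem, card_insert_of_notMem, card_pair hlp]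
    · simp [hjl, hjp]
    · simp [hij, hil, hip]
  · simp
  · simp [hi, hj, hl, hp]
  · subst hi hj hl
    simp [Perm.SameCycle.refl]

/-- The inverse of `threeRuns k u y`, extended by `threeRuns k u y`. -/
def threeRunsSwap (k u y i : ℕ) : ℕ :=
  if i ≤ k then threeRuns k u y i else if i ≤ k + 1 + u then k + 1 + u - i else
    if i ≤ k + y then k + 1 + u + y - i else 2 * k + 1 + y - i

/-- The primitive permutation with one back point attached to `u < y ≤ k`. -/
def modelOne (k u y i : ℕ) : ℕ :=
  if i = y then 0 else if i = k + 1 + u then y else threeRunsSwap k u y i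

/-- A function constant on the cycles of `modelOne k u y`. -/
def modelOneInvariant (k u y i : ℕ) : ℕ :=
  if i = y ∨ i = k + 1 + u then 0 else if i ≤ k then i else modelOne k u y i

/-- A function constant on the cycles of the dual of `modelOne k u y`. -/
def modelOneDualInvariant (k u y i : ℕ) : ℕ :=
  if i = k then u else if i ≤ k then i else modelOne k u y i - 1

/-- A function constant on the cycles of the primitive permutation with two back points
attached to `u < y ≤ k`. -/
def modelTwoInvariant (k u y i : ℕ) : ℕ :=
  if i = y then 0 else if i ≤ k then i else if i = k + 1 then
    (if u + 1 = y then 0 else u + 1) else threeRunsSwap k u y (i - 1)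

lemma threeRunsSwap_swap {k u y : ℕ} (hu : u < y) (hy : y ≤ k) {i : ℕ} (hi : i < 2 * k + 2) :
    threeRunsSwap k u y i < 2 * k + 2 ∧
      threeRunsSwap k u y (threeRunsSwap k u y i) = i := by
  unfold threeRunsSwap threeRuns
  grind (splits := 25)

lemma threeRunsSwap_ne {k u y : ℕ} (hu : u < y) (hy : y ≤ k) (i : ℕ) :
    threeRunsSwap k u y i ≠ i := by
  unfold threeRunsSwap threeRuns
  grind (splits := 25)

lemma modelOne_lt {u y : ℕ} (hu : u < y) (hy : y ≤ k)
    (i : ℕ) : modelOne k u y i < 2 * k + 1 := by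
  unfold modelOne threeRunsSwap threeRuns
  grind (splits := 25)

lemma modelOne_injOn {u y : ℕ} (hu : u < y) (hy : y ≤ k)
    (i : ℕ) (hi : i < 2 * k + 1) (j : ℕ) (hj : j < 2 * k + 1)
    (h : modelOne k u y i = modelOne k u y j) : i = j := by
  unfold modelOne threeRunsSwap threeRuns at h
  grind (splits := 25)

lemma modelOne_ne {u y : ℕ} (hu : u < y) (hy : y ≤ k)
    (i : ℕ) (hi : i < 2 * k + 1) :
    modelOne k u y i ≠ i ∧ modelOne k u y i ≠ if i + 1 = 2 * k + 1 then 0 else i + 1 := by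
  unfold modelOne threeRunsSwap threeRuns
  grind (splits := 25)

lemma modelOne_invariant {u y : ℕ} (hu : u < y) (hy : y ≤ k)
    (i : ℕ) (hi : i < 2 * k + 1) :
    modelOneInvariant k u y (modelOne k u y i) = modelOneInvariant k u y i := by
  unfold modelOneInvariant modelOne threeRunsSwap threeRuns
  grind (splits := 25)

lemma modelOne_dual_invariant {u y : ℕ} (hu : u < y) (hy : y ≤ k)
    (i j : ℕ) (hi : i < 2 * k + 1) (hj : j < 2 * k + 1)
    (h : modelOne k u y i = if j + 1 = 2 * k + 1 then 0 else j + 1) :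
    modelOneDualInvariant k u y i = modelOneDualInvariant k u y j := by
  unfold modelOneDualInvariant
  unfold modelOne threeRunsSwap threeRuns at *
  grind (splits := 25)

lemma threeRunsSwap_ne_sub {u y : ℕ} (hu : u < y) (hy : y ≤ k)
    (i : ℕ) (hi : i < 2 * k + 2) :
    (if threeRunsSwap k u y i + 1 = 2 * k + 2 then 0 else threeRunsSwap k u y i + 1) ≠ i := by
  unfold threeRunsSwap threeRuns
  grind (splits := 25)

lemma modelTwo_invariant {u y : ℕ} (hu : u < y) (hy : y ≤ k)
    (i j : ℕ) (hi : i < 2 * k + 2)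
    (hj : j = if threeRunsSwap k u y i + 1 = 2 * k + 2 then 0 else threeRunsSwap k u y i + 1) :
    modelTwoInvariant k u y j = modelTwoInvariant k u y i := by
  unfold modelTwoInvariant
  unfold threeRunsSwap threeRuns at *
  grind (splits := 25)

end Models

section ModelPerms

open Equiv Finset

variable {k u y : ℕ}

/-- The permutation of `Fin (2 * k + 1)` given by `modelOne`. -/
noncomputable def modelOnePerm (hu : u < y) (hy : y ≤ k) : Perm (Fin (2 * k + 1)) :=
  permOfNat (modelOne k u y) (fun i _ => modelOne_lt hu hy i) (modelOne_injOn hu hy)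

/-- The involution of `Fin (2 * k + 2)` given by `threeRunsSwap`. -/
noncomputable def swapPerm (hu : u < y) (hy : y ≤ k) : Perm (Fin (2 * k + 2)) :=
  permOfNat (threeRunsSwap k u y) (fun _ hi => (threeRunsSwap_swap hu hy hi).1)
    fun i hi j hj h => by
      rw [← (threeRunsSwap_swap hu hy hi).2, h, (threeRunsSwap_swap hu hy hj).2]

/-- The primitive permutation with two back points attached to `u < y ≤ k`. -/
noncomputable def modelTwoPerm (hu : u < y) (hy : y ≤ k) : Perm (Fin (2 * k + 2)) :=
  finRotate _ * swapPerm hu hy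

lemma modelOnePerm_val (hu : u < y) (hy : y ≤ k) (i : Fin (2 * k + 1)) :
    (modelOnePerm hu hy i : ℕ) = modelOne k u y i := rfl

lemma swapPerm_val (hu : u < y) (hy : y ≤ k) (i : Fin (2 * k + 2)) :
    (swapPerm hu hy i : ℕ) = threeRunsSwap k u y i := rfl

lemma modelTwoPerm_val (hu : u < y) (hy : y ≤ k) (i : Fin (2 * k + 2)) :
    (modelTwoPerm hu hy i : ℕ) = if threeRunsSwap k u y i + 1 = 2 * k + 2 then 0
      else threeRunsSwap k u y i + 1 := by
  rw [modelTwoPerm, Perm.mul_apply, finRotate_val, swapPerm_val]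

lemma isPrimitiveGenusOne_modelOnePerm (hu : u < y) (hy : y ≤ k) :
    IsPrimitiveGenusOne (2 * k + 1) k (modelOnePerm hu hy) := by
  refine isPrimitiveGenusOne_of_invariants (by omega)
    ⟨fun i hi => (modelOne_ne hu hy i i.2).1 (congrArg Fin.val hi),
      fun i hi => (modelOne_ne hu hy i i.2).2 ?_⟩
    (modelOneInvariant k u y) (modelOneDualInvariant k u y)
    (fun i => modelOne_invariant hu hy i i.2)
    (fun i j hij => modelOne_dual_invariant hu hy i j i.2 j.2 ?_)
    ((range (k + 1)).erase y) (range k) (fun x hx => ?_) (fun x hx => ?_) ?_ ?_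
  · rw [← finRotate_val, ← hi, modelOnePerm_val]
  · rw [← finRotate_val, ← hij, modelOnePerm_val]
  · simp only [mem_erase, mem_range] at hx
    exact ⟨x, by omega, by
      rw [modelOneInvariant, if_neg (by omega), if_pos (by omega)]⟩
  · have := mem_range.1 hx
    exact ⟨x, by omega, by
      rw [modelOneDualInvariant, if_neg (by omega), if_pos (by omega)]⟩
  · rw [card_erase_of_mem (mem_range.2 (by omega)), card_range]; rfl
  · rw [card_erase_of_mem (mem_range.2 (by omega)), card_range, card_range]; omega

lemma isPrimitiveGenusOne_modelTwoPerm (hu : u < y) (hy : y ≤ k) :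
    IsPrimitiveGenusOne (2 * k + 2) k (modelTwoPerm hu hy) := by
  refine isPrimitiveGenusOne_of_invariants (by omega)
    ⟨fun i hi => threeRunsSwap_ne_sub hu hy i i.2 ?_,
      fun i hi => threeRunsSwap_ne hu hy i ?_⟩
    (modelTwoInvariant k u y) (fun i => min i (threeRunsSwap k u y i))
    (fun i => modelTwo_invariant hu hy i _ i.2 (modelTwoPerm_val hu hy i))
    (fun i j hij => ?_)
    ((range (k + 1)).erase y) (range (k + 1)) (fun x hx => ?_) (fun x hx => ?_) ?_ ?_
  · rw [← modelTwoPerm_val hu hy, hi]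
  · rw [← swapPerm_val hu hy, (finRotate _).injective hi]
  · have h := congrArg Fin.val ((finRotate _).injective hij)
    rw [swapPerm_val] at h
    have h' := (threeRunsSwap_swap hu hy i.2).2
    rw [h] at h'
    simp only [h, h', min_comm]
  · simp only [mem_erase, mem_range] at hx
    exact ⟨x, by omega, by
      rw [modelTwoInvariant, if_neg (by omega), if_pos (by omega)]⟩
  · have := mem_range.1 hx
    refine ⟨x, by omega, min_eq_left ?_⟩
    unfold threeRunsSwap threeRuns
    split_ifs <;> omega
  · rw [card_erase_of_mem (mem_range.2 (by omega)), card_range]; rfl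
  · rw [card_erase_of_mem (mem_range.2 (by omega)), card_range]; omega

lemma exists_eq_modelOnePerm {α : Perm (Fin (2 * k + 1))}
    (h : IsPrimitiveGenusOne (2 * k + 1) k α) (h0 : α (α 0) ≠ 0) :
    ∃ u y, ∃ (hu : u < y) (hy : y ≤ k), modelOnePerm hu hy = α := by
  have h0' : natFun α (natFun α 0) ≠ 0 := by
    have e : natFun α (natFun α ((0 : Fin (2 * k + 1)) : ℕ)) = α (α 0) := by
      rw [natFun_val, natFun_val]
    exact fun h => h0 (Fin.ext (e.symm.trans h))
  obtain ⟨u, y, hu, hy, hy0, hrun, haa⟩ := h.isPrimitivePair.eq_threeRuns_of_one h0'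
  refine ⟨u, y, hu, hy, Equiv.ext fun i => Fin.ext ?_⟩
  rw [modelOnePerm_val, ← natFun_val]
  have hi := i.2
  generalize (i : ℕ) = i at hi
  by_cases hiy : i = y
  · rw [hiy, hy0, modelOne, if_pos rfl]
  by_cases hik : i ≤ k
  · rw [hrun i hik hiy]
    unfold modelOne threeRunsSwap
    rw [if_neg hiy, if_neg (by omega), if_pos hik]
  · have key : ∀ w ≤ k, w ≠ y → threeRuns k u y w = i →
        natFun α i = if w = 0 then y else w := by
      intro w hw hwy hwi
      rw [← haa w hw hwy, hrun w hw hwy, hwi]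
    by_cases hiu : i = k + 1 + u
    · rw [key 0 (by omega) (by omega) (by unfold threeRuns; rw [if_pos (by omega)]; omega),
        if_pos rfl, modelOne, if_neg hiy, if_pos hiu]
    · rw [key (threeRunsSwap k u y i), if_neg]
      · rw [modelOne, if_neg hiy, if_neg hiu]
      all_goals unfold threeRunsSwap
      all_goals try unfold threeRuns
      all_goals split_ifs <;> omega

lemma exists_eq_modelTwoPerm {α : Perm (Fin (2 * k + 2))}
    (h : IsPrimitiveGenusOne (2 * k + 2) k α) (h0 : α (α 0) ≠ 0) :
    ∃ u y, ∃ (hu : u < y) (hy : y ≤ k), modelTwoPerm hu hy = α := by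
  have h0' : natFun α (natFun α 0) ≠ 0 := by
    have e : natFun α (natFun α ((0 : Fin (2 * k + 2)) : ℕ)) = α (α 0) := by
      rw [natFun_val, natFun_val]
    exact fun h => h0 (Fin.ext (e.symm.trans h))
  obtain ⟨u, y, hu, hy, hrun, hbb⟩ := h.isPrimitivePair.eq_threeRuns_of_two h0'
  refine ⟨u, y, hu, hy, ?_⟩
  have hσ : ∀ i, (α⁻¹ * finRotate (2 * k + 2)) (swapPerm hu hy i) = i := by
    intro i
    refine Fin.ext ?_
    rw [← natFun_val, swapPerm_val]
    have hi := i.2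
    generalize (i : ℕ) = i at hi
    by_cases hik : i ≤ k
    · have e : threeRunsSwap k u y i = threeRuns k u y i := if_pos hik
      rw [e, ← hrun i hik, hbb i hik]
    · have hs := (threeRunsSwap_swap hu hy hi).2
      have hle : threeRunsSwap k u y i ≤ k := by
        unfold threeRunsSwap
        split_ifs <;> omega
      rw [hrun _ hle]
      rwa [threeRunsSwap, if_pos hle] at hs
  refine Equiv.ext fun i => ?_
  have := hσ i
  rw [Perm.mul_apply, Perm.inv_eq_iff_eq] at this
  rw [modelTwoPerm, Perm.mul_apply, this]

lemma cycleSize_modelOnePerm (hu : u < y) (hy : y ≤ k) :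
    cycleSize (modelOnePerm hu hy) 0 = 3 := by
  refine cycleSize_eq_three (j := ⟨k + 1 + u, by omega⟩) (l := ⟨y, by omega⟩) (Fin.ext ?_)
    (Fin.ext ?_) (Fin.ext ?_) (Fin.ne_of_val_ne ?_) (Fin.ne_of_val_ne ?_) (Fin.ne_of_val_ne ?_)
  all_goals simp only [modelOnePerm_val, Fin.val_zero]
  all_goals first | omega | (unfold modelOne threeRunsSwap threeRuns; grind)

lemma cycleSize_modelTwoPerm (hu : u < y) (hy : y ≤ k) :
    cycleSize (modelTwoPerm hu hy) 0 = if u + 1 = y then 4 else 3 := by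
  split_ifs with h
  · refine cycleSize_eq_four (j := ⟨k + 2 + u, by omega⟩) (l := ⟨k + 1, by omega⟩)
      (p := ⟨y, by omega⟩) (Fin.ext ?_) (Fin.ext ?_) (Fin.ext ?_) (Fin.ext ?_)
      (Fin.ne_of_val_ne ?_) (Fin.ne_of_val_ne ?_) (Fin.ne_of_val_ne ?_) (Fin.ne_of_val_ne ?_)
      (Fin.ne_of_val_ne ?_) (Fin.ne_of_val_ne ?_)
    all_goals simp only [modelTwoPerm_val, Fin.val_zero]
    all_goals first | omega | (unfold threeRunsSwap threeRuns; grind)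
  · refine cycleSize_eq_three (j := ⟨k + 2 + u, by omega⟩) (l := ⟨y, by omega⟩) (Fin.ext ?_)
      (Fin.ext ?_) (Fin.ext ?_) (Fin.ne_of_val_ne ?_) (Fin.ne_of_val_ne ?_)
      (Fin.ne_of_val_ne ?_)
    all_goals simp only [modelTwoPerm_val, Fin.val_zero]
    all_goals first | omega | (unfold threeRunsSwap threeRuns; grind)

lemma modelOnePerm_injective {u' y' : ℕ} (hu : u < y) (hy : y ≤ k) (hu' : u' < y')
    (hy' : y' ≤ k) (h : modelOnePerm hu hy = modelOnePerm hu' hy') : u = u' ∧ y = y' := by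
  have h1 := congrArg Fin.val (DFunLike.congr_fun h 0)
  have h2 := congrArg Fin.val (DFunLike.congr_fun h ⟨y, by omega⟩)
  rw [modelOnePerm_val, modelOnePerm_val] at h1 h2
  unfold modelOne threeRunsSwap threeRuns at h1 h2
  simp only [Fin.val_zero] at h1 h2
  grind (splits := 25)

lemma modelTwoPerm_injective {u' y' : ℕ} (hu : u < y) (hy : y ≤ k) (hu' : u' < y')
    (hy' : y' ≤ k) (h : modelTwoPerm hu hy = modelTwoPerm hu' hy') : u = u' ∧ y = y' := by
  have h := mul_left_cancel h
  have h1 := congrArg Fin.val (DFunLike.congr_fun h 0)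
  have h2 := congrArg Fin.val (DFunLike.congr_fun h ⟨y, by omega⟩)
  rw [swapPerm_val, swapPerm_val] at h1 h2
  unfold threeRunsSwap threeRuns at h1 h2
  simp only [Fin.val_zero] at h1 h2
  grind (splits := 25)

end ModelPerms

section Counting

open Equiv Finset

open Classical in
/-- Reduction of the count of primitive permutations to a weighted count of pairs. -/
lemma card_primitive_eq_sum_pairs {m k : ℕ} (hm : 0 < m)
    (M : ∀ {u y : ℕ}, u < y → y ≤ k → Perm (Fin m)) (w : ℕ → ℕ → ℚ)
    (hM : ∀ {u y} (hu : u < y) (hy : y ≤ k), IsPrimitiveGenusOne m k (M hu hy))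
    (hw : ∀ {u y} (hu : u < y) (hy : y ≤ k),
      1 - 2 / (cycleSize (M hu hy) ⟨0, hm⟩ : ℚ) = w u y) (hw0 : ∀ u y, w u y ≠ 0)
    (hinj : ∀ {u y u' y'} (hu : u < y) (hy : y ≤ k) (hu' : u' < y') (hy' : y' ≤ k),
      M hu hy = M hu' hy' → u = u' ∧ y = y')
    (hsurj : ∀ α, IsPrimitiveGenusOne m k α → α (α ⟨0, hm⟩) ≠ ⟨0, hm⟩ →
      ∃ u y, ∃ (hu : u < y) (hy : y ≤ k), M hu hy = α) :
    ((m : ℚ) - 2 * k) * #{α : Perm (Fin m) | IsPrimitiveGenusOne m k α} =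
      m * ∑ y ∈ range (k + 1), ∑ u ∈ range y, w u y := by
  rw [card_primitive_eq_sum_cycleSize hm, sum_sigma' (range (k + 1)) range fun y u => w u y]
  have hmem : ∀ x ∈ (range (k + 1)).sigma range, x.2 < x.1 ∧ x.1 ≤ k := by
    intro x hx
    simp only [mem_sigma, mem_range] at hx
    omega
  congr 1
  symm
  refine sum_bij_ne_zero (fun x hx _ => M (hmem x hx).1 (hmem x hx).2) (fun x hx _ => ?_)
    (fun x hx _ x' hx' _ h => ?_) (fun α hα hne => ?_) (fun x hx _ => ?_)
  · exact mem_filter.2 ⟨mem_univ _, hM _ _⟩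
  · obtain ⟨h1, h2⟩ := hinj _ _ _ _ h
    exact Sigma.ext h2 (heq_of_eq h1)
  · have hα' := (mem_filter.1 hα).2
    obtain ⟨u, y, hu, hy, rfl⟩ := hsurj α hα' fun h => hne (by
      rw [cycleSize_eq_two h (hα'.1.1 _)]
      norm_num)
    exact ⟨⟨y, u⟩, by simp only [mem_sigma, mem_range]; omega, hw0 u y, rfl⟩
  · exact (hw _ _).symm

lemma six_mul_choose_three (n : ℕ) :
    6 * ((n + 2).choose 3 : ℚ) = (n + 2) * (n + 1) * n := by
  have h := Nat.descFactorial_eq_factorial_mul_choose (n + 2) 3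
  simp only [Nat.descFactorial_succ, Nat.descFactorial_zero, Nat.factorial] at h
  have h' : 6 * (n + 2).choose 3 = (n + 2) * (n + 1) * n := by
    simp only [Nat.sub_zero, Nat.add_sub_cancel, mul_one] at h
    rw [show n + 2 - 1 = n + 1 from rfl] at h
    linarith
  exact_mod_cast h'

lemma card_primitive_one (k : ℕ) :
    Nat.card {α : Perm (Fin (2 * k + 1)) // IsPrimitiveGenusOne (2 * k + 1) k α} =
      (k + 2).choose 3 + (k + 1).choose 3 := by
  classical
  rw [Nat.card_eq_fintype_card, Fintype.card_subtype]
  have h := card_primitive_eq_sum_pairs (m := 2 * k + 1) (k := k) (by omega) modelOnePerm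
    (fun _ _ => 1 / 3) isPrimitiveGenusOne_modelOnePerm
    (fun hu hy => by
      have : cycleSize (modelOnePerm hu hy) ⟨0, by omega⟩ = 3 := cycleSize_modelOnePerm hu hy
      rw [this]; norm_num)
    (fun _ _ => by norm_num) modelOnePerm_injective (fun α hα h => exists_eq_modelOnePerm hα h)
  have hsum : ∀ k : ℕ, ∑ y ∈ range (k + 1), ∑ u ∈ range y, (1 / 3 : ℚ) = (k + 1) * k / 6 := by
    intro k
    induction k with
    | zero => simp
    | succ k ih =>
      rw [sum_range_succ, ih, sum_const, card_range, nsmul_eq_mul]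
      push_cast
      ring
  rw [hsum] at h
  have h1 := six_mul_choose_three k
  have h2 : 6 * ((k + 1).choose 3 : ℚ) = (k + 1) * k * (k - 1) := by
    cases k with
    | zero => simp [Nat.choose]
    | succ k =>
      rw [six_mul_choose_three]
      push_cast
      ring
  have : (#{α | IsPrimitiveGenusOne (2 * k + 1) k α} : ℚ) =
      (k + 2).choose 3 + (k + 1).choose 3 := by
    push_cast at h
    linear_combination h - h1 / 6 - h2 / 6
  exact_mod_cast this

lemma card_primitive_two (k : ℕ) :
    Nat.card {α : Perm (Fin (2 * k + 2)) // IsPrimitiveGenusOne (2 * k + 2) k α} =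
      (k + 2).choose 3 := by
  classical
  rw [Nat.card_eq_fintype_card, Fintype.card_subtype]
  have h := card_primitive_eq_sum_pairs (m := 2 * k + 2) (k := k) (by omega) modelTwoPerm
    (fun u y => if u + 1 = y then 1 / 2 else 1 / 3) isPrimitiveGenusOne_modelTwoPerm
    (fun {u y} hu hy => by
      have : cycleSize (modelTwoPerm hu hy) ⟨0, by omega⟩ = if u + 1 = y then 4 else 3 :=
        cycleSize_modelTwoPerm hu hy
      rw [this]
      split_ifs <;> norm_num)
    (fun u y => by split_ifs <;> norm_num) modelTwoPerm_injective
    (fun α hα h => exists_eq_modelTwoPerm hα h)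
  have hsum : ∀ k : ℕ, ∑ y ∈ range (k + 1), ∑ u ∈ range y,
      (if u + 1 = y then 1 / 2 else 1 / 3 : ℚ) = k * (k + 2) / 6 := by
    intro k
    induction k with
    | zero => simp
    | succ k ih =>
      rw [sum_range_succ, ih, sum_range_succ, if_pos rfl,
        sum_congr rfl (g := fun _ => (1 / 3 : ℚ)) fun u hu =>
          if_neg (by have := mem_range.1 hu; omega), sum_const, card_range, nsmul_eq_mul]
      push_cast
      ring
  rw [hsum] at h
  have h1 := six_mul_choose_three k
  have : (#{α | IsPrimitiveGenusOne (2 * k + 2) k α} : ℚ) = (k + 2).choose 3 := by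
    push_cast at h
    linear_combination h / 2 - h1 / 6
  exact_mod_cast this

end Counting

/-- For `n ≥ 0` and `k ≥ 1`, the numbers `r₁(n,k)` and `r₂(n,k)` of reduced genus-one
permutations of `{1,…,n}` with `k` cycles and exactly one (resp. two) back points
satisfy `r₁(n,k) = C(n,2k+1)·(C(k+2,3)+C(k+1,3))` and `r₂(n,k) = C(n,2k+2)·C(k+2,3)`. -/
theorem reduced_genus_one_backpoint_counts (n k : ℕ) (hk : 1 ≤ k) :
    Nat.card {α : Equiv.Perm (Fin n) //
          IsGenusOne α ∧ IsReducedPerm α ∧ backPointCount α = 1 ∧ zPerm α = k} =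
        n.choose (2 * k + 1) * ((k + 2).choose 3 + (k + 1).choose 3) ∧
    Nat.card {α : Equiv.Perm (Fin n) //
          IsGenusOne α ∧ IsReducedPerm α ∧ backPointCount α = 2 ∧ zPerm α = k} =
        n.choose (2 * k + 2) * (k + 2).choose 3 := by
  constructor
  · rw [← card_primitive_one]
    exact card_reduced n k 1 hk
  · rw [← card_primitive_two]
    exact card_reduced n k 2 hk
end

section
/- Every permutation α of {1,…,n} of genus 1 has at most two back points; consequently exactly one of the following holds: (1) α has no back points (so α corresponds to a partition); (2) α has exactly one back point; (3) α has exactly two back points and they lie in the same cycle of α; (4) α has exactly two back points and they lie in two different cycles of α. -/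
open Classical in
/-- The cycles of `α` are counted by the preimages under `α` of their smallest elements. -/
lemma zPerm_eq_card_filter {n : ℕ} (α : Equiv.Perm (Fin n)) :
    zPerm α = (Finset.univ.filter fun i : Fin n => ∀ j, α.SameCycle i j → α i ≤ j).card := by
  rw [← Fintype.card_subtype, ← Nat.card_eq_fintype_card, zPerm]
  refine (Nat.card_congr (Equiv.ofBijective
    (fun i : {i : Fin n // ∀ j, α.SameCycle i j → α i ≤ j} =>
      (Quotient.mk (cycleSetoid α) i.1)) ⟨?_, ?_⟩)).symm
  · rintro ⟨i, hi⟩ ⟨j, hj⟩ hij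
    have hs : α.SameCycle i j := Quotient.exact hij
    exact Subtype.ext (α.injective (le_antisymm
      (hi _ (Equiv.Perm.sameCycle_apply_right.2 hs))
      (hj _ (Equiv.Perm.sameCycle_apply_right.2 hs.symm))))
  · intro q
    obtain ⟨x, rfl⟩ := Quotient.exists_rep q
    obtain ⟨m, hm, hmin⟩ := (Finset.univ.filter fun j => α.SameCycle x j).exists_min_image id
      ⟨x, by simp [Equiv.Perm.SameCycle.refl]⟩
    simp only [Finset.mem_filter, Finset.mem_univ, true_and, id] at hm hmin
    have hx : α.SameCycle (α⁻¹ m) x := Equiv.Perm.sameCycle_apply_left.1 (by simpa using hm.symm)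
    exact ⟨⟨α⁻¹ m, fun j hj => by simpa using hmin j (hx.symm.trans hj)⟩, Quotient.sound hx⟩

/-- Each weak anti-excedance is either a back point or maps to the minimum of its cycle. -/
lemma card_apply_le_eq {n : ℕ} (α : Equiv.Perm (Fin n)) :
    (Finset.univ.filter fun i : Fin n => α i ≤ i).card = backPointCount α + zPerm α := by
  classical
  rw [zPerm_eq_card_filter, backPointCount, Nat.card_eq_fintype_card, Fintype.card_subtype,
    ← Finset.card_union_of_disjoint]
  · congr 1
    ext i
    simp only [Finset.mem_filter, Finset.mem_univ, true_and, Finset.mem_union]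
    constructor
    · intro hi
      by_cases hmin : ∀ j, α.SameCycle i j → α i ≤ j
      · exact Or.inr hmin
      · push Not at hmin
        refine Or.inl ⟨lt_of_le_of_ne hi fun hfix => ?_, hmin⟩
        obtain ⟨j, hj, hlt⟩ := hmin
        obtain rfl : i = j := hj.eq_of_left hfix
        exact hlt.ne hfix.symm
    · rintro (hi | hi)
      · exact hi.1.le
      · exact hi i (Equiv.Perm.SameCycle.refl α i)
  · rw [Finset.disjoint_filter]
    rintro i - ⟨-, j, hj, hlt⟩ hmin
    exact (hmin j hj).not_gt hlt

/-- The weak anti-excedances of `α` and of `α⁻¹ * ζₙ` are together `n + 1` in number. -/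
lemma card_apply_le_add {m : ℕ} (α : Equiv.Perm (Fin (m + 1))) :
    (Finset.univ.filter fun i => α i ≤ i).card +
      (Finset.univ.filter fun i => (α⁻¹ * finRotate (m + 1)) i ≤ i).card = m + 2 := by
  set β := α⁻¹ * finRotate (m + 1) with hβ
  have hα : (Finset.univ.filter fun i => α i ≤ i).card =
      (Finset.univ.filter fun i => finRotate (m + 1) i ≤ β i).card := by
    refine (Finset.card_equiv β fun i => ?_).symm
    simp [hβ]
  have hstep (i : Fin (m + 1)) : (if finRotate (m + 1) i ≤ β i then 1 else 0) +
      (if β i ≤ i then 1 else 0) = 1 + if i = Fin.last m then 1 else 0 := by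
    by_cases hi : i = Fin.last m
    · simp [hi, Fin.le_last]
    · have hval := coe_finRotate_of_ne_last hi
      simp only [Fin.le_def, hval, hi, if_false]
      split_ifs <;> omega
  rw [hα, Finset.card_filter, Finset.card_filter, ← Finset.sum_add_distrib,
    Finset.sum_congr rfl fun i _ => hstep i]
  simp [Finset.sum_add_distrib]

/-- The back points of `α` and of `α⁻¹ * ζₙ` are together twice the genus in number. -/
lemma backPointCount_add_of_isGenusOne {n : ℕ} {α : Equiv.Perm (Fin n)} (h : IsGenusOne α) :
    backPointCount α + backPointCount (α⁻¹ * finRotate n) = 2 := by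
  unfold IsGenusOne at h
  cases n with
  | zero => omega
  | succ m =>
    have hsum := card_apply_le_add α
    rw [card_apply_le_eq, card_apply_le_eq] at hsum
    omega

/-- A genus-one permutation of `{1,…,n}` has at most two back points, and exactly one
of the following holds: it has no back point (so it corresponds to a partition), it
has exactly one back point, it has exactly two back points lying in the same cycle,
or it has exactly two back points lying in two different cycles. -/
theorem genus_one_backpoint_trichotomy (n : ℕ) (α : Equiv.Perm (Fin n))
    (h : IsGenusOne α) :
    backPointCount α ≤ 2 ∧
      ((backPointCount α = 0 ∧ IsPartitionPerm α) ∨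
        backPointCount α = 1 ∨
        (backPointCount α = 2 ∧ ∃ i j : Fin n, i ≠ j ∧ IsBackPoint α i ∧
          IsBackPoint α j ∧ α.SameCycle i j) ∨
        (backPointCount α = 2 ∧ ∃ i j : Fin n, i ≠ j ∧ IsBackPoint α i ∧
          IsBackPoint α j ∧ ¬ α.SameCycle i j)) := by
  have hle : backPointCount α ≤ 2 := by
    have := backPointCount_add_of_isGenusOne h
    omega
  refine ⟨hle, ?_⟩
  obtain h0 | h1 | h2 : backPointCount α = 0 ∨ backPointCount α = 1 ∨ backPointCount α = 2 := by
    omega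
  · refine Or.inl ⟨h0, fun i hi => ?_⟩
    have := Finite.card_eq_zero_iff.1 h0
    exact this.false ⟨i, hi⟩
  · exact Or.inr (Or.inl h1)
  · obtain ⟨⟨i, hi⟩, ⟨j, hj⟩, hij, -⟩ := Nat.card_eq_two_iff.1 h2
    have hne : i ≠ j := fun e => hij (Subtype.ext e)
    by_cases hs : α.SameCycle i j
    · exact Or.inr (Or.inr (Or.inl ⟨h2, i, j, hne, hi, hj, hs⟩))
    · exact Or.inr (Or.inr (Or.inr ⟨h2, i, j, hne, hi, hj, hs⟩))
end

section
/- Let θ and α be permutations of {1,…,n} such that θ is an n-cycle (z(θ) = 1) and the hypermap (θ, α) has genus 0, i.e., z(α) + z(α⁻¹ ∘ θ) = n + 1. If some x ∈ {1,…,n} satisfies α(x) = θ^k(x) for an integer k with 1 < k < n, then there exist integers 1 ≤ i ≤ j ≤ k−1 such that α(θ^s(x)) = θ^{s+1}(x) for all i ≤ s < j and α(θ^j(x)) = θ^i(x); in other words, α has a cycle consisting of consecutive points of the sequence θ(x), θ²(x), …, θ^{k−1}(x). -/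
theorem isCycleOn_univ_of_zPerm_eq_one {n : ℕ} {θ : Equiv.Perm (Fin n)} (hθ : zPerm θ = 1) :
    θ.IsCycleOn ((Finset.univ : Finset (Fin n)) : Set (Fin n)) := by
  obtain ⟨h, -⟩ := Nat.card_eq_one_iff_unique.mp hθ
  refine ⟨by simp, fun p _ q _ => ?_⟩
  exact Quotient.exact (s := cycleSetoid θ) (Subsingleton.elim (Quotient.mk _ p) (Quotient.mk _ q))

/-- Multiplying `α` by the transposition of `x` and `α x ≠ x` detaches the fixed point `x` from
its cycle, which increases the number of cycles. -/
theorem zPerm_lt_zPerm_swap_mul {n : ℕ} (α : Equiv.Perm (Fin n)) {x : Fin n} (hx : α x ≠ x) :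
    zPerm α < zPerm (Equiv.swap x (α x) * α) := by
  set α' := Equiv.swap x (α x) * α with hα'
  have hfix : α' x = x := by simp [hα']
  have hstep : ∀ p, α.SameCycle p (α' p) := by
    intro p
    simp only [hα', Equiv.Perm.mul_apply, Equiv.swap_apply_def]
    split_ifs with h1 h2
    · exact (Equiv.Perm.sameCycle_apply_right.mpr (h1 ▸ Equiv.Perm.sameCycle_apply_right.mpr
        (Equiv.Perm.SameCycle.refl α p)))
    · rw [α.injective h2]
    · exact Equiv.Perm.sameCycle_apply_right.mpr (Equiv.Perm.SameCycle.refl α p)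
  have hpow : ∀ (m : ℕ) p, α.SameCycle p ((α' ^ m) p) := by
    intro m
    induction m with
    | zero => exact fun p => Equiv.Perm.SameCycle.refl α p
    | succ m ih =>
      intro p
      rw [pow_succ', Equiv.Perm.mul_apply]
      exact (ih p).trans (hstep _)
  have hle : ∀ p q, α'.SameCycle p q → α.SameCycle p q := by
    intro p q h
    obtain ⟨m, -, rfl⟩ := h.exists_pow_eq'
    exact hpow m p
  let F : Quotient (cycleSetoid α') → Quotient (cycleSetoid α) :=
    Quotient.map' id fun p q h => hle p q h
  classical
  have := Fintype.ofFinite (Quotient (cycleSetoid α'))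
  have := Fintype.ofFinite (Quotient (cycleSetoid α))
  rw [zPerm, zPerm, Nat.card_eq_fintype_card, Nat.card_eq_fintype_card]
  refine Fintype.card_lt_of_surjective_not_injective F ?_ ?_
  · rintro ⟨p⟩
    exact ⟨Quotient.mk _ p, rfl⟩
  · intro hinj
    have h : (Quotient.mk (cycleSetoid α') x) = Quotient.mk (cycleSetoid α') (α x) :=
      hinj (Quotient.sound (s := cycleSetoid α)
        (Equiv.Perm.sameCycle_apply_right.mpr (Equiv.Perm.SameCycle.refl α x)))
    have h' : α'.SameCycle x (α x) := Quotient.exact (s := cycleSetoid α') h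
    exact hx (h'.eq_of_left hfix).symm

/-- If the only functions invariant under both `α` and `β` are the constant ones, then
`z(α) + z(β) ≤ n + 1`. -/
theorem zPerm_add_zPerm_le {n : ℕ} (α β : Equiv.Perm (Fin n)) (x : Fin n)
    (h : ∀ f : Fin n → ℚ, (∀ p, f (α p) = f p) → (∀ p, f (β p) = f p) → ∀ p, f p = f x) :
    zPerm α + zPerm β ≤ n + 1 := by
  classical
  have := Fintype.ofFinite (Quotient (cycleSetoid α))
  have := Fintype.ofFinite (Quotient (cycleSetoid β))
  let T : ((Quotient (cycleSetoid α) → ℚ) × (Quotient (cycleSetoid β) → ℚ)) →ₗ[ℚ] (Fin n → ℚ) :=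
    (LinearMap.funLeft ℚ ℚ (Quotient.mk (cycleSetoid α))).coprod
      (LinearMap.funLeft ℚ ℚ (Quotient.mk (cycleSetoid β)))
  have hT : ∀ u p, T u p = u.1 (Quotient.mk _ p) + u.2 (Quotient.mk _ p) := fun u p => by
    simp [T, LinearMap.funLeft_apply]
  have hker : Module.finrank ℚ (LinearMap.ker T) ≤ 1 := by
    have hle : LinearMap.ker T ≤ Submodule.span ℚ {((fun _ => 1), (fun _ => -1))} := by
      intro u hu
      have hu' : ∀ p, u.1 (Quotient.mk _ p) + u.2 (Quotient.mk _ p) = 0 := fun p => by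
        rw [← hT, LinearMap.mem_ker.mp hu, Pi.zero_apply]
      have hα : ∀ p, Quotient.mk (cycleSetoid α) (α p) = Quotient.mk _ p := fun p =>
        Quotient.sound (s := cycleSetoid α)
          (Equiv.Perm.sameCycle_apply_left.mpr (Equiv.Perm.SameCycle.refl α p))
      have hβ : ∀ p, Quotient.mk (cycleSetoid β) (β p) = Quotient.mk _ p := fun p =>
        Quotient.sound (s := cycleSetoid β)
          (Equiv.Perm.sameCycle_apply_left.mpr (Equiv.Perm.SameCycle.refl β p))
      have hc := h (fun p => u.1 (Quotient.mk _ p)) (fun p => by simp only [hα])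
        (fun p => by
          have h1 := hu' p
          have h2 := hu' (β p)
          rw [hβ] at h2
          linarith)
      rw [Submodule.mem_span_singleton]
      refine ⟨u.1 (Quotient.mk _ x), ?_⟩
      ext q
      · induction q using Quotient.inductionOn with
        | h p => simpa using (hc p).symm
      · induction q using Quotient.inductionOn with
        | h p =>
          have h1 := hu' p
          have h2 := hc p
          simp only [Prod.smul_mk, Pi.smul_apply, smul_eq_mul]
          linarith
    exact (Submodule.finrank_mono hle).trans ((finrank_span_le_card _).trans (by simp))
  have hrange : Module.finrank ℚ (LinearMap.range T) ≤ n := by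
    simpa using Submodule.finrank_le (LinearMap.range T)
  have hrank := LinearMap.finrank_range_add_finrank_ker T
  rw [Module.finrank_prod, Module.finrank_pi, Module.finrank_pi] at hrank
  rw [zPerm, zPerm, Nat.card_eq_fintype_card, Nat.card_eq_fintype_card]
  omega

/-- In genus zero, if `α x = θᵏ x` then `α` stabilizes the arc `θ x, …, θ^(k-1) x`. -/
theorem exists_apply_pow_eq_of_genus_zero {n : ℕ} {θ α : Equiv.Perm (Fin n)}
    (hθ : zPerm θ = 1) (hg : zPerm α + zPerm (α⁻¹ * θ) = n + 1)
    {x : Fin n} {k : ℕ} (hk0 : 0 < k) (hkn : k < n) (hx : α x = (θ ^ k) x)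
    {i : ℕ} (hi0 : 0 < i) (hik : i < k) :
    ∃ m, 0 < m ∧ m < k ∧ α ((θ ^ i) x) = (θ ^ m) x := by
  have hcyc := isCycleOn_univ_of_zPerm_eq_one hθ
  have hinj : ∀ {a b : ℕ}, a < n → b < n → (θ ^ a) x = (θ ^ b) x → a = b := by
    intro a b ha hb hab
    have := (hcyc.pow_apply_eq_pow_apply (Finset.mem_univ x)).mp hab
    rw [Finset.card_univ, Fintype.card_fin] at this
    exact this.eq_of_lt_of_lt ha hb
  have hsurj : ∀ p, ∃ m < n, (θ ^ m) x = p := by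
    intro p
    simpa using hcyc.exists_pow_eq (Finset.mem_univ x) (Finset.mem_univ p)
  have hαx : α x ≠ x := fun h0 => hk0.ne' (hinj hkn (by omega) (by rw [← hx, h0]; rfl))
  by_contra! hno
  obtain ⟨m, hmn, hm⟩ := hsurj (α ((θ ^ i) x))
  have hm' : m = 0 ∨ k ≤ m := by
    by_contra! hcon
    exact hno m (by omega) hcon.2 hm.symm
  have hmk : m ≠ k := by
    rintro rfl
    have : (θ ^ 0) x = (θ ^ i) x := α.injective (by rw [← hm, ← hx]; rfl)
    have := hinj (by omega) (by omega) this
    omega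
  have hlt := zPerm_lt_zPerm_swap_mul α hαx
  have hle := zPerm_add_zPerm_le (Equiv.swap x (α x) * α) (α⁻¹ * θ) x ?_
  · omega
  intro f hfα hfβ
  have hfθ : ∀ p, f (Equiv.swap x (α x) (θ p)) = f p := by
    intro p
    have h1 := hfα ((α⁻¹ * θ) p)
    rw [hfβ p] at h1
    simpa using h1
  have hstep : ∀ s, s + 1 < n → s + 1 ≠ k → f ((θ ^ (s + 1)) x) = f ((θ ^ s) x) := by
    intro s hs hsk
    rw [← hfθ ((θ ^ s) x), ← Equiv.Perm.mul_apply θ, ← pow_succ', Equiv.swap_apply_of_ne_of_ne]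
    · intro h0
      exact absurd (hinj hs (by omega) (b := 0) h0) (by omega)
    · rw [hx]
      exact fun h0 => hsk (hinj hs hkn h0)
  have hlow : ∀ s, s < k → f ((θ ^ s) x) = f x := by
    intro s
    induction s with
    | zero => exact fun _ => rfl
    | succ s ih => exact fun hs => (hstep s (by omega) (by omega)).trans (ih (by omega))
  have hhigh : ∀ s, k ≤ s → s < n → f ((θ ^ s) x) = f (α x) := by
    intro s hs
    induction s, hs using Nat.le_induction with
    | base => exact fun _ => by rw [hx]
    | succ s hs ih => exact fun hsn => (hstep s hsn (by omega)).trans (ih (by omega))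
  have hxy : f (α x) = f x := by
    have h1 := hfα ((θ ^ i) x)
    rw [Equiv.Perm.mul_apply, ← hm, hlow i hik] at h1
    rcases hm' with rfl | hkm
    · simpa using h1
    · rw [Equiv.swap_apply_of_ne_of_ne, hhigh m hkm hmn] at h1
      · exact h1
      · intro h0
        exact absurd (hinj hmn (by omega) (b := 0) h0) (by omega)
      · rw [hx]
        exact fun h0 => hmk (hinj hmn hkn h0)
  intro p
  obtain ⟨s, hsn, rfl⟩ := hsurj p
  rcases lt_or_ge s k with hs | hs
  · exact hlow s hs
  · exact (hhigh s hs hsn).trans hxy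

/-- An arc stabilized by a genus zero permutation contains a cycle of consecutive points. -/
theorem exists_consecutive_cycle_of_mapsTo {n : ℕ} {θ α : Equiv.Perm (Fin n)}
    (hθ : zPerm θ = 1) (hg : zPerm α + zPerm (α⁻¹ * θ) = n + 1) (x : Fin n) (L : ℕ) :
    ∀ a b : ℕ, b - a = L → a ≤ b → b < n →
      (∀ s, a ≤ s → s ≤ b → ∃ t, a ≤ t ∧ t ≤ b ∧ α ((θ ^ s) x) = (θ ^ t) x) →
      ∃ i j : ℕ, a ≤ i ∧ i ≤ j ∧ j ≤ b ∧
        (∀ s : ℕ, i ≤ s → s < j → α ((θ ^ s) x) = (θ ^ (s + 1)) x) ∧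
        α ((θ ^ j) x) = (θ ^ i) x := by
  induction L using Nat.strong_induction_on with
  | _ L ih =>
  intro a b hL hab hbn hmaps
  by_cases hjump : ∃ s t, a ≤ s ∧ s + 1 < t ∧ t ≤ b ∧ α ((θ ^ s) x) = (θ ^ t) x
  · obtain ⟨s, t, has, hst, htb, hα⟩ := hjump
    have hα' : α ((θ ^ s) x) = (θ ^ (t - s)) ((θ ^ s) x) := by
      rw [hα, ← Equiv.Perm.mul_apply, ← pow_add, Nat.sub_add_cancel (by omega)]
    obtain ⟨i, j, h1, h2, h3, h4⟩ := ih (t - 1 - (s + 1)) (by omega) (s + 1) (t - 1) rfl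
      (by omega) (by omega) (by
        intro r hr1 hr2
        obtain ⟨m, hm0, hm1, hm⟩ := exists_apply_pow_eq_of_genus_zero hθ hg (by omega) (by omega)
          hα' (i := r - s) (by omega) (by omega)
        refine ⟨m + s, by omega, by omega, ?_⟩
        rwa [← Equiv.Perm.mul_apply (θ ^ (r - s)), ← Equiv.Perm.mul_apply (θ ^ m), ← pow_add,
          ← pow_add, Nat.sub_add_cancel (by omega)] at hm)
    exact ⟨i, j, by omega, h2, by omega, h4⟩
  · push Not at hjump
    have hback : ∃ s, a ≤ s ∧ s ≤ b ∧ ∃ t, a ≤ t ∧ t ≤ s ∧ α ((θ ^ s) x) = (θ ^ t) x := by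
      obtain ⟨t, ht⟩ := hmaps b hab le_rfl
      exact ⟨b, hab, le_rfl, t, ht⟩
    classical
    obtain ⟨has, hsb, t, hat, hts, hα⟩ := Nat.find_spec hback
    have hmin : ∀ r, a ≤ r → r < Nat.find hback → α ((θ ^ r) x) = (θ ^ (r + 1)) x := by
      intro r har hr
      obtain ⟨u, hau, hub, hu⟩ := hmaps r har (by omega)
      have h1 : ¬ u ≤ r := fun hur =>
        Nat.find_min hback hr ⟨har, by omega, u, hau, hur, hu⟩
      have h2 : ¬ r + 1 < u := fun hur => hjump r u har hur hub hu
      rw [hu, show u = r + 1 by omega]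
    have hta : t = a := by
      by_contra hne
      have h1 := hmin (t - 1) (by omega) (by omega)
      rw [Nat.sub_add_cancel (by omega), ← hα] at h1
      have h2 := ((isCycleOn_univ_of_zPerm_eq_one hθ).pow_apply_eq_pow_apply
        (Finset.mem_univ x)).mp (α.injective h1)
      rw [Finset.card_univ, Fintype.card_fin] at h2
      have := h2.eq_of_lt_of_lt (by omega) (by omega)
      omega
    exact ⟨a, Nat.find hback, le_rfl, has, hsb, hmin, hta ▸ hα⟩

/-- Let `θ` be an `n`-cycle and `α` a permutation such that the hypermap `(θ, α)` has
genus 0, i.e. `z(α) + z(α⁻¹ ∘ θ) = n + 1`. If `α(x) = θᵏ(x)` for some `1 < k < n`,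
then `α` has a cycle consisting of consecutive points of the sequence
`θ(x), θ²(x), …, θ^(k−1)(x)`: there are `1 ≤ i ≤ j ≤ k−1` with
`α(θˢ(x)) = θ^(s+1)(x)` for `i ≤ s < j` and `α(θʲ(x)) = θⁱ(x)`. -/
theorem exists_consecutive_cycle (n : ℕ) (θ α : Equiv.Perm (Fin n))
    (hθ : zPerm θ = 1) (hg : zPerm α + zPerm (α⁻¹ * θ) = n + 1)
    (x : Fin n) (k : ℕ) (hk1 : 1 < k) (hkn : k < n) (hx : α x = (θ ^ k) x) :
    ∃ i j : ℕ, 1 ≤ i ∧ i ≤ j ∧ j ≤ k - 1 ∧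
      (∀ s : ℕ, i ≤ s → s < j → α ((θ ^ s) x) = (θ ^ (s + 1)) x) ∧
      α ((θ ^ j) x) = (θ ^ i) x := by
  refine exists_consecutive_cycle_of_mapsTo hθ hg x _ 1 (k - 1) rfl (by omega) (by omega) ?_
  intro s hs1 hs2
  obtain ⟨m, hm0, hmk, hm⟩ := exists_apply_pow_eq_of_genus_zero hθ hg (by omega) hkn hx
    (i := s) (by omega) (by omega)
  exact ⟨m, by omega, by omega, hm⟩
end
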